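/- arXiv:2112.15042 — 3 statements merged into one kernel-verified Lean document; each statement's English description precedes it below -/
import Mathlib

section
/- Let X₁,…,X_d be distinct real numbers, λ > 0, and 1 ≤ s < d. Let 𝕏_{1:s} be the set of the s largest values among X₁,…,X_d, let η̂*^{(s)} = (1(X₁ ∈ 𝕏_{1:s}),…,1(X_d ∈ 𝕏_{1:s})), and let η̄_λ = (1(X₁ > λ),…,1(X_d > λ)) be the thresholding selector. Then for any binary vector η ∈ {0,1}^d with exactly s nonzero components, |η̂*^{(s)} − η| ≤ 2|η̄_λ − η|, where |·| denotes the Hamming distance |a − b| = Σ_{j=1}^d 1(a_j ≠ b_j). -/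
open Finset
open scoped Classical

noncomputable section

/-- Number of nonzero components of a binary vector. -/
def sparsity {d : ℕ} (η : Fin d → Bool) : ℕ := (univ.filter fun j => η j = true).card

/-- Hamming distance between two binary vectors. -/
def hamming {d : ℕ} (a b : Fin d → Bool) : ℕ := (univ.filter fun j => a j ≠ b j).card

/-- The number of entries of `X` strictly above the `i`-th one. -/
def numAbove {d : ℕ} (X : Fin d → ℝ) (i : Fin d) : ℕ := (univ.filter fun k => X i < X k).card

lemma numAbove_anti {d : ℕ} (X : Fin d → ℝ) {i j : Fin d} (h : X i ≤ X j) :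
    numAbove X j ≤ numAbove X i :=
  card_le_card fun k hk => by
    simp only [mem_filter, mem_univ, true_and] at hk ⊢
    exact h.trans_lt hk

lemma numAbove_strictAnti {d : ℕ} (X : Fin d → ℝ) {i j : Fin d} (h : X i < X j) :
    numAbove X j < numAbove X i := by
  refine card_lt_card (ssubset_iff_of_subset ?_ |>.2 ⟨j, ?_, ?_⟩)
  · intro k hk
    simp only [mem_filter, mem_univ, true_and] at hk ⊢
    exact h.trans hk
  · simpa using h
  · simp

lemma numAbove_injective {d : ℕ} {X : Fin d → ℝ} (hX : Function.Injective X) :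
    Function.Injective (numAbove X) := by
  intro i j hij
  by_contra hne
  rcases lt_or_gt_of_ne (hX.ne hne) with h | h
  · exact (numAbove_strictAnti X h).ne hij.symm
  · exact (numAbove_strictAnti X h).ne hij

lemma numAbove_lt {d : ℕ} (X : Fin d → ℝ) (i : Fin d) : numAbove X i < d := by
  have h : numAbove X i < (univ : Finset (Fin d)).card :=
    card_lt_card (ssubset_iff_of_subset (subset_univ _) |>.2 ⟨i, mem_univ i, by simp⟩)
  simpa using h

lemma image_numAbove {d : ℕ} {X : Fin d → ℝ} (hX : Function.Injective X) :
    univ.image (numAbove X) = range d := by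
  refine eq_of_subset_of_card_le ?_ ?_
  · intro n hn
    obtain ⟨i, -, rfl⟩ := mem_image.1 hn
    exact mem_range.2 (numAbove_lt X i)
  · simp [card_image_of_injective _ (numAbove_injective hX)]

lemma card_filter_numAbove_lt {d s : ℕ} {X : Fin d → ℝ} (hX : Function.Injective X)
    (hsd : s ≤ d) : (univ.filter fun i => numAbove X i < s).card = s := by
  rw [← card_image_of_injective _ (numAbove_injective hX)]
  have h : (univ.filter fun i => numAbove X i < s).image (numAbove X) = range s := by
    ext n
    simp only [mem_image, mem_filter, mem_univ, true_and, mem_range]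
    constructor
    · rintro ⟨i, hi, rfl⟩
      exact hi
    · intro hn
      have hmem : n ∈ univ.image (numAbove X) := by
        rw [image_numAbove hX]
        exact mem_range.2 (hn.trans_le hsd)
      obtain ⟨i, -, rfl⟩ := mem_image.1 hmem
      exact ⟨i, hn, rfl⟩
  rw [h, card_range]

lemma hamming_decide {d : ℕ} (p : Fin d → Prop) [DecidablePred p] (η : Fin d → Bool) :
    hamming (fun i => decide (p i)) η =
      (univ.filter p \ univ.filter fun i => η i = true).card +
        ((univ.filter fun i => η i = true) \ univ.filter p).card := by
  rw [← card_union_of_disjoint disjoint_sdiff_sdiff]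
  unfold hamming
  congr 1
  ext i
  cases h : η i <;> simp [h]

/-- Proposition 5 of the paper: for distinct reals `X₁,…,X_d`, any `λ > 0`
and any `s`-sparse binary vector `η`, the Hamming loss of the top-`s` selector
`η̂*^{(s)} = (1(X_i ∈ 𝕏_{1:s}))_i` is at most twice the Hamming loss of the thresholding
selector `η̄_λ = (1(X_i > λ))_i`. -/
theorem statement12 (d s : ℕ) (hs : 1 ≤ s) (hsd : s < d)
    (X : Fin d → ℝ) (hX : Function.Injective X)
    (lam : ℝ) (hlam : 0 < lam)
    (η : Fin d → Bool) (hη : sparsity η = s) :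
    hamming (fun i => decide ((univ.filter fun k => X i < X k).card < s)) η
      ≤ 2 * hamming (fun i => decide (lam < X i)) η := by
  set N := univ.filter fun i => η i = true with hN
  set T := univ.filter fun i => numAbove X i < s with hT
  set L := univ.filter fun i => lam < X i with hL
  have hcard : (T \ N).card = (N \ T).card :=
    card_sdiff_comm ((card_filter_numAbove_lt hX hsd.le).trans hη.symm)
  have hTop : hamming (fun i => decide ((univ.filter fun k => X i < X k).card < s)) η =
      (T \ N).card + (N \ T).card := by
    convert hamming_decide (fun i => numAbove X i < s) η
    rfl
  have hThr : hamming (fun i => decide (lam < X i)) η = (L \ N).card + (N \ L).card := by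
    convert hamming_decide (fun i => lam < X i) η
  rw [hTop, hThr]
  have hcomp : T ⊆ L ∨ L ⊆ T := by
    by_contra! h
    obtain ⟨i, hiT, hiL⟩ := not_subset.1 h.1
    obtain ⟨j, hjL, hjT⟩ := not_subset.1 h.2
    simp only [hT, hL, mem_filter, mem_univ, true_and, not_lt] at hiT hiL hjL hjT
    have := numAbove_anti X (hiL.trans hjL.le)
    omega
  rcases hcomp with h | h
  · have := card_le_card (sdiff_subset_sdiff h (Subset.refl N))
    omega
  · have := card_le_card (sdiff_subset_sdiff (Subset.refl N) h)
    omega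

end
end

section
/- Let ν > 1. There exist positive constants c(ν) and c'(ν) depending only on ν, with c'(ν) ≥ min{t ≥ e : ν log t > c(ν) log log t}, such that: (i) whenever min(d−s, s) > c'(ν) and a < σ( (ν log(d−s) − c(ν) log log(d−s))^{1/ν} + (ν log s − c(ν) log log s)^{1/ν} ), one has inf over all selectors η̃ of sup_{F ∈ 𝒫_ν} sup_{μ ∈ Θ_d(s,a)} E_{μ,F}|η̃ − η(μ)| ≥ inf over all selectors η̃ of sup_{F ∈ 𝒫_ν} sup_{μ ∈ Θ_d(s,a)} P_{μ,F}(S_{η̃} ≠ S_{η(μ)}) ≥ (1 − e^{−1})²; (ii) if for some A > 1 one has min(d/s − 1, A) > c'(ν) and a < σ( (ν log(d/s − 1) − c(ν) log log(d/s − 1))^{1/ν} + (ν log A − c(ν) log log A)^{1/ν} ), then inf over all selectors η̃ of sup_{F ∈ 𝒫_ν} sup_{μ ∈ Θ_d(s,a)} (1/s) E_{μ,F}|η̃ − η(μ)| ≥ (1 − e^{−1})/A. -/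
open MeasureTheory Finset Filter
open scoped ENNReal Classical

noncomputable section

/-- The sparsity class `Θ_d(s,a)` of mean vectors. -/
def ThetaLoc (d s : ℕ) (a : ℝ) : Set (Fin d → ℝ) :=
  {μ | ∃ S : Finset (Fin d), S.card = s ∧ (∀ j ∈ S, a ≤ μ j) ∧ ∀ j ∉ S, μ j = 0}

/-- The binary vector `η(μ)` of nonzero positions of `μ`. -/
def etaOf {d : ℕ} (μ : Fin d → ℝ) : Fin d → Bool := fun j => decide (μ j ≠ 0)

/-- The law `P_{μ,F}` of the observations `X_i = μ_i + σ ξ_i` with i.i.d. noise of law `Q`. -/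
def Ploc (σ : ℝ) (Q : Measure ℝ) {d : ℕ} (μ : Fin d → ℝ) : Measure (Fin d → ℝ) :=
  Measure.pi fun i => Q.map fun x => μ i + σ * x

/-- The class `𝒫_ν` of noise distributions (identified with their laws): probability measures
`Q` on `ℝ` whose c.d.f. `F` satisfies `1 − F(u) ≤ e^{−u^ν/ν}` and `F(−u) ≤ e^{−u^ν/ν}` for all
`u ≥ 0`. -/
def Pclass (ν : ℝ) : Set (Measure ℝ) :=
  {Q | IsProbabilityMeasure Q ∧ ∀ u : ℝ, 0 ≤ u →
      (Q (Set.Ioi u)).toReal ≤ Real.exp (-(u ^ ν) / ν) ∧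
      (Q (Set.Iic (-u))).toReal ≤ Real.exp (-(u ^ ν) / ν)}

/-- Expected Hamming risk of a nonrandomized selector in the location model. -/
def detRiskLoc (σ : ℝ) (Q : Measure ℝ) {d : ℕ}
    (sel : (Fin d → ℝ) → Fin d → Bool) (μ : Fin d → ℝ) : ℝ :=
  ∫ X, (hamming (sel X) (etaOf μ) : ℝ) ∂(Ploc σ Q μ)

/-- The set of maximal (over `F ∈ 𝒫_ν` and `μ ∈ Θ_d(s,a)`) expected Hamming risks of all
(randomized, measurable) selectors in the location model. -/
def HamRiskSetLoc (ν σ : ℝ) (d s : ℕ) (a : ℝ) : Set ℝ :=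
  { r | ∃ (Z : Type) (_ : MeasurableSpace Z) (ζ : Measure Z),
      IsProbabilityMeasure ζ ∧
      ∃ sel : (Fin d → ℝ) → Z → Fin d → Bool,
        Measurable (Function.uncurry sel) ∧
        r = ⨆ Q : Pclass ν, ⨆ μ : ThetaLoc d s a,
              ∫ z, ∫ X, (hamming (sel X z) (etaOf μ.1) : ℝ) ∂(Ploc σ Q.1 μ.1) ∂ζ }

/-- The set of maximal (over `F ∈ 𝒫_ν` and `μ ∈ Θ_d(s,a)`) probabilities of wrong recovery of
all (randomized, measurable) selectors in the location model. -/
def WrongRiskSetLoc (ν σ : ℝ) (d s : ℕ) (a : ℝ) : Set ℝ :=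
  { r | ∃ (Z : Type) (_ : MeasurableSpace Z) (ζ : Measure Z),
      IsProbabilityMeasure ζ ∧
      ∃ sel : (Fin d → ℝ) → Z → Fin d → Bool,
        Measurable (Function.uncurry sel) ∧
        r = ⨆ Q : Pclass ν, ⨆ μ : ThetaLoc d s a,
              ∫ z, ((Ploc σ Q.1 μ.1) {X | sel X z ≠ etaOf μ.1}).toReal ∂ζ }

theorem sum_prod_mul_prod {d : ℕ} {T : Type} [Fintype T] (m : T → ℝ) (hm : ∑ t, m t = 1)
    (K : Finset (Fin d)) (h : Fin d → T → ℝ) :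
    ∑ ω : Fin d → T, (∏ k, m (ω k)) * ∏ k ∈ K, h k (ω k) = ∏ k ∈ K, ∑ t, m t * h k t := by
  have h1 : ∀ ω : Fin d → T, (∏ k, m (ω k)) * ∏ k ∈ K, h k (ω k)
      = ∏ k, m (ω k) * (if k ∈ K then h k (ω k) else 1) := by
    intro ω
    rw [Finset.prod_mul_distrib]
    simp [Finset.prod_ite_mem]
  simp_rw [h1]
  have h2 := (Finset.prod_univ_sum (fun _ : Fin d => (univ : Finset T))
    (fun k t => m t * (if k ∈ K then h k t else 1))).symm
  rw [Fintype.piFinset_univ] at h2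
  rw [h2]
  have h3 : ∀ k, ∑ t, m t * (if k ∈ K then h k t else 1)
      = if k ∈ K then ∑ t, m t * h k t else 1 := by
    intro k
    split_ifs <;> simp [hm]
  simp_rw [h3]
  simp [Finset.prod_ite_mem]

/-- The three point distribution on `Fin 3` with weights `1 - p - q`, `p`, `q`. -/
def threeWeight (p q : ℝ) : Fin 3 → ℝ := ![1 - p - q, p, q]

/-- Indicator that the `i`-th coordinate is zero and is moved to the ambiguous value. -/
def ambigZero {d : ℕ} (S : Finset (Fin d)) (ω : Fin d → Fin 3) (i : Fin d) : ℝ :=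
  if i ∉ S ∧ ω i = 1 then 1 else 0

/-- Indicator that the `j`-th coordinate is nonzero and is moved to the ambiguous value. -/
def ambigOne {d : ℕ} (S : Finset (Fin d)) (ω : Fin d → Fin 3) (j : Fin d) : ℝ :=
  if j ∈ S ∧ ω j = 2 then 1 else 0

/-- Observation obtained from the support `S` and the noise configuration `ω`. -/
def obs {d : ℕ} (b σ : ℝ) (v : Fin 3 → ℝ) (S : Finset (Fin d)) (ω : Fin d → Fin 3) :
    Fin d → ℝ := fun k => (if k ∈ S then b else 0) + σ * v (ω k)

theorem sum_powersetCard_perm {d : ℕ} (s : ℕ) (e : Equiv.Perm (Fin d))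
    (f : Finset (Fin d) → ℝ) :
    ∑ S ∈ powersetCard s univ, f (S.map e.toEmbedding) = ∑ S ∈ powersetCard s univ, f S := by
  refine Finset.sum_equiv e.finsetCongr ?_ ?_
  · intro S; simp [Finset.mem_powersetCard]
  · intro S _; rfl

theorem obs_swap {d : ℕ} {b σ : ℝ} {v : Fin 3 → ℝ} (hv : σ * v 1 = b + σ * v 2)
    (S : Finset (Fin d)) (ω : Fin d → Fin 3) {i j : Fin d} (hi : i ∉ S) (hωi : ω i = 1)
    (hj : j ∈ S) (hωj : ω j = 2) :
    obs b σ v (S.map (Equiv.swap i j).toEmbedding) (ω ∘ Equiv.swap i j) = obs b σ v S ω := by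
  have hmem : ∀ k, k ∈ S.map (Equiv.swap i j).toEmbedding ↔ Equiv.swap i j k ∈ S := by
    intro k; rw [Finset.mem_map_equiv, Equiv.symm_swap]
  funext k
  simp only [obs, hmem, Function.comp]
  by_cases hki : k = i
  · subst hki; simp [hi, hj, hωi, hωj, hv]
  by_cases hkj : k = j
  · subst hkj; simp [hi, hj, hωi, hωj, hv]
  rw [Equiv.swap_apply_of_ne_of_ne hki hkj]

/-- Exchanging an ambiguous zero with an ambiguous nonzero coordinate does not change the
observation, so every weighted sum over ambiguous pairs can be symmetrized. -/
theorem sum_swap {d : ℕ} (s : ℕ) {b σ : ℝ} {v : Fin 3 → ℝ} (hv : σ * v 1 = b + σ * v 2)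
    (m : Fin 3 → ℝ) (g : ℝ → ℝ → ℝ)
    (L : Fin d → Fin d → (Fin d → ℝ) → Finset (Fin d) → ℝ) :
    ∑ S ∈ powersetCard s (univ : Finset (Fin d)), ∑ ω : Fin d → Fin 3, (∏ k, m (ω k)) *
        (g (∑ i, ambigZero S ω i) (∑ j, ambigOne S ω j) *
          ∑ i, ∑ j, ambigZero S ω i * ambigOne S ω j * L i j (obs b σ v S ω) S)
    = ∑ S ∈ powersetCard s (univ : Finset (Fin d)), ∑ ω : Fin d → Fin 3, (∏ k, m (ω k)) *
        (g (∑ i, ambigZero S ω i) (∑ j, ambigOne S ω j) *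
          ∑ i, ∑ j, ambigZero S ω i * ambigOne S ω j *
            L j i (obs b σ v S ω) (S.map (Equiv.swap i j).toEmbedding)) := by
  have expand : ∀ M : Fin d → Fin d → (Fin d → Fin 3) → Finset (Fin d) → ℝ,
      ∑ S ∈ powersetCard s (univ : Finset (Fin d)), ∑ ω : Fin d → Fin 3, (∏ k, m (ω k)) *
        (g (∑ i, ambigZero S ω i) (∑ j, ambigOne S ω j) *
          ∑ i, ∑ j, ambigZero S ω i * ambigOne S ω j * M i j ω S)
      = ∑ i, ∑ j, ∑ S ∈ powersetCard s (univ : Finset (Fin d)), ∑ ω : Fin d → Fin 3,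
        (∏ k, m (ω k)) * (g (∑ i, ambigZero S ω i) (∑ j, ambigOne S ω j) *
          (ambigZero S ω i * ambigOne S ω j * M i j ω S)) := by
    intro M
    simp_rw [Finset.mul_sum]
    have h1 : ∀ H : Finset (Fin d) → (Fin d → Fin 3) → Fin d → Fin d → ℝ,
        ∑ S ∈ powersetCard s (univ : Finset (Fin d)), ∑ ω : Fin d → Fin 3, ∑ i, ∑ j, H S ω i j
        = ∑ i, ∑ j, ∑ S ∈ powersetCard s (univ : Finset (Fin d)), ∑ ω : Fin d → Fin 3,
          H S ω i j := by
      intro H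
      have h2 : ∀ S, ∑ ω : Fin d → Fin 3, ∑ i, ∑ j, H S ω i j
          = ∑ i, ∑ j, ∑ ω : Fin d → Fin 3, H S ω i j := by
        intro S
        rw [Finset.sum_comm]
        exact Finset.sum_congr rfl fun i _ => Finset.sum_comm
      simp_rw [h2]
      rw [Finset.sum_comm]
      exact Finset.sum_congr rfl fun i _ => Finset.sum_comm
    exact h1 _
  rw [expand (fun i j ω S => L i j (obs b σ v S ω) S),
    expand (fun i j ω S => L j i (obs b σ v S ω) (S.map (Equiv.swap i j).toEmbedding)),
    Finset.sum_comm]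
  refine Finset.sum_congr rfl fun j _ => Finset.sum_congr rfl fun i _ => ?_
  rw [← sum_powersetCard_perm s (Equiv.swap j i)]
  refine Finset.sum_congr rfl fun S _ => ?_
  rw [← Equiv.sum_comp (Equiv.arrowCongr (Equiv.swap j i) (Equiv.refl (Fin 3)))]
  refine Finset.sum_congr rfl fun ω _ => ?_
  have hω : (Equiv.arrowCongr (Equiv.swap j i) (Equiv.refl (Fin 3))) ω
      = ω ∘ Equiv.swap j i := by
    funext k; simp [Equiv.arrowCongr]
  have hmem : ∀ k, k ∈ S.map (Equiv.swap j i).toEmbedding ↔ Equiv.swap j i k ∈ S := by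
    intro k; rw [Finset.mem_map_equiv, Equiv.symm_swap]
  have hZ : ∀ k, ambigZero (S.map (Equiv.swap j i).toEmbedding) (ω ∘ Equiv.swap j i) k
      = ambigZero S ω (Equiv.swap j i k) := by
    intro k; simp only [ambigZero, hmem, Function.comp]
  have hO : ∀ k, ambigOne (S.map (Equiv.swap j i).toEmbedding) (ω ∘ Equiv.swap j i) k
      = ambigOne S ω (Equiv.swap j i k) := by
    intro k; simp only [ambigOne, hmem, Function.comp]
  rw [hω]
  simp only [hZ, hO]
  rw [Equiv.sum_comp (Equiv.swap j i) (ambigZero S ω),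
    Equiv.sum_comp (Equiv.swap j i) (ambigOne S ω)]
  have hw : ∏ k, m ((ω ∘ Equiv.swap j i) k) = ∏ k, m (ω k) :=
    Equiv.prod_comp (Equiv.swap j i) fun k => m (ω k)
  rw [hw, Equiv.swap_apply_left, Equiv.swap_apply_right]
  by_cases hj : j ∉ S ∧ ω j = 1
  · by_cases hi : i ∈ S ∧ ω i = 2
    · rw [obs_swap hv S ω hj.1 hj.2 hi.1 hi.2]
    · simp [ambigOne, hi]
  · simp [ambigZero, hj]

theorem sum_threeWeight (p q : ℝ) : ∑ t, threeWeight p q t = 1 := by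
  simp [threeWeight, Fin.sum_univ_three]
  ring

theorem threeWeight_nonneg {p q : ℝ} (hp : 0 ≤ p) (hq : 0 ≤ q) (hpq : p + q ≤ 1) (t : Fin 3) :
    0 ≤ threeWeight p q t := by
  fin_cases t <;> simp [threeWeight] <;> linarith

/-- Weight of the noise configuration `ω`. -/
def configWeight {d : ℕ} (p q : ℝ) (ω : Fin d → Fin 3) : ℝ := ∏ k, threeWeight p q (ω k)

theorem configWeight_nonneg {d : ℕ} {p q : ℝ} (hp : 0 ≤ p) (hq : 0 ≤ q) (hpq : p + q ≤ 1)
    (ω : Fin d → Fin 3) : 0 ≤ configWeight p q ω :=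
  Finset.prod_nonneg fun _ _ => threeWeight_nonneg hp hq hpq _

theorem sum_configWeight {d : ℕ} (p q : ℝ) : ∑ ω : Fin d → Fin 3, configWeight p q ω = 1 := by
  simpa [configWeight] using
    sum_prod_mul_prod (threeWeight p q) (sum_threeWeight p q) (∅ : Finset (Fin d)) fun _ _ => 1

theorem ambigZero_nonneg {d : ℕ} (S : Finset (Fin d)) (ω : Fin d → Fin 3) (i : Fin d) :
    0 ≤ ambigZero S ω i := by
  unfold ambigZero; split_ifs <;> norm_num

theorem ambigOne_nonneg {d : ℕ} (S : Finset (Fin d)) (ω : Fin d → Fin 3) (j : Fin d) :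
    0 ≤ ambigOne S ω j := by
  unfold ambigOne; split_ifs <;> norm_num

theorem ambigOne_le {d : ℕ} (S : Finset (Fin d)) (ω : Fin d → Fin 3) (j : Fin d) :
    ambigOne S ω j ≤ if j ∈ S then 1 else 0 := by
  unfold ambigOne; split_ifs <;> simp_all

/-- The binary vector with support `S`. -/
def chi {d : ℕ} (S : Finset (Fin d)) : Fin d → Bool := fun k => decide (k ∈ S)

theorem chi_injective {d : ℕ} : Function.Injective (chi (d := d)) := by
  intro S S' h
  ext k
  simpa [chi] using congrFun h k

theorem one_sub_le_ambig {d s : ℕ} {p q : ℝ} {S : Finset (Fin d)} (hS : S.card = s)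
    (hp : 0 ≤ p) (hq : 0 ≤ q) (hpq : p + q ≤ 1) :
    1 - (1 - p) ^ (d - s) - (1 - q) ^ s ≤ ∑ ω : Fin d → Fin 3, configWeight p q ω *
      (if (∑ i, ambigZero S ω i) * (∑ j, ambigOne S ω j) = 0 then 0 else 1) := by
  have hA := sum_prod_mul_prod (threeWeight p q) (sum_threeWeight p q) Sᶜ
    fun _ t => if t = 1 then 0 else 1
  have hB := sum_prod_mul_prod (threeWeight p q) (sum_threeWeight p q) S
    fun _ t => if t = 2 then 0 else 1
  have hA' : ∑ t, threeWeight p q t * (if t = 1 then 0 else 1) = 1 - p := by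
    simp [threeWeight, Fin.sum_univ_three]
  have hB' : ∑ t, threeWeight p q t * (if t = 2 then 0 else 1) = 1 - q := by
    simp [threeWeight, Fin.sum_univ_three]
    ring
  simp only [hA', hB', Finset.prod_const, Finset.card_compl, Fintype.card_fin, hS] at hA hB
  rw [← hA, ← hB]
  nth_rewrite 1 [← sum_configWeight (d := d) p q]
  rw [← Finset.sum_sub_distrib, ← Finset.sum_sub_distrib]
  refine Finset.sum_le_sum fun ω _ => ?_
  have hw := configWeight_nonneg hp hq hpq ω
  change configWeight p q ω - configWeight p q ω * _ - configWeight p q ω * _ ≤ _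
  have hPA : (0 : ℝ) ≤ ∏ k ∈ Sᶜ, if ω k = 1 then 0 else 1 :=
    Finset.prod_nonneg fun _ _ => by split_ifs <;> norm_num
  have hPB : (0 : ℝ) ≤ ∏ k ∈ S, if ω k = 2 then 0 else 1 :=
    Finset.prod_nonneg fun _ _ => by split_ifs <;> norm_num
  split_ifs with h
  · rcases mul_eq_zero.1 h with h | h
    · rw [Finset.sum_eq_zero_iff_of_nonneg fun i _ => ambigZero_nonneg S ω i] at h
      have : (∏ k ∈ Sᶜ, if ω k = 1 then (0 : ℝ) else 1) = 1 := by
        refine Finset.prod_eq_one fun k hk => ?_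
        have hk2 := h k (Finset.mem_univ _)
        rw [Finset.mem_compl] at hk
        simp only [ambigZero, hk, not_false_eq_true, true_and] at hk2
        split_ifs at hk2 ⊢ <;> simp_all
      rw [this]; nlinarith
    · rw [Finset.sum_eq_zero_iff_of_nonneg fun i _ => ambigOne_nonneg S ω i] at h
      have : (∏ k ∈ S, if ω k = 2 then (0 : ℝ) else 1) = 1 := by
        refine Finset.prod_eq_one fun k hk => ?_
        have hk2 := h k (Finset.mem_univ _)
        simp only [ambigOne, hk, true_and] at hk2
        split_ifs at hk2 ⊢ <;> simp_all
      rw [this]; nlinarith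
  · nlinarith [mul_nonneg hw hPA, mul_nonneg hw hPB]

theorem wrong_average {d s : ℕ} {b σ : ℝ} {v : Fin 3 → ℝ} (hv : σ * v 1 = b + σ * v 2)
    {p q : ℝ} (hp : 0 ≤ p) (hq : 0 ≤ q) (hpq : p + q ≤ 1)
    (D : (Fin d → ℝ) → Fin d → Bool) :
    ((powersetCard s (univ : Finset (Fin d))).card : ℝ) *
        ((1 - (1 - p) ^ (d - s) - (1 - q) ^ s) / 2)
      ≤ ∑ S ∈ powersetCard s (univ : Finset (Fin d)), ∑ ω : Fin d → Fin 3,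
          configWeight p q ω * (if D (obs b σ v S ω) ≠ chi S then 1 else 0) := by
  set g : ℝ → ℝ → ℝ := fun x y => (x * y)⁻¹ with hg
  have key := sum_swap s hv (threeWeight p q) g
    fun _ _ X S => if D X ≠ chi S then 1 else 0
  have h1 : ∀ S : Finset (Fin d), ∀ ω : Fin d → Fin 3, ∀ c : ℝ,
      g (∑ i, ambigZero S ω i) (∑ j, ambigOne S ω j) *
        ∑ i, ∑ j, ambigZero S ω i * ambigOne S ω j * c
      = (if (∑ i, ambigZero S ω i) * (∑ j, ambigOne S ω j) = 0 then 0 else 1) * c := by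
    intro S ω c
    have : ∑ i, ∑ j, ambigZero S ω i * ambigOne S ω j * c
        = (∑ i, ambigZero S ω i) * (∑ j, ambigOne S ω j) * c := by
      rw [Finset.sum_mul_sum, Finset.sum_mul]
      exact Finset.sum_congr rfl fun i _ => by rw [Finset.sum_mul]
    rw [this, hg]
    split_ifs with h
    · simp [h]
    · simp only; rw [← mul_assoc, inv_mul_cancel₀ h]
  have h2 : ∑ S ∈ powersetCard s (univ : Finset (Fin d)), ∑ ω : Fin d → Fin 3,
      configWeight p q ω *
        (if (∑ i, ambigZero S ω i) * (∑ j, ambigOne S ω j) = 0 then 0 else 1)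
      ≤ ∑ S ∈ powersetCard s (univ : Finset (Fin d)), ∑ ω : Fin d → Fin 3,
        configWeight p q ω * (g (∑ i, ambigZero S ω i) (∑ j, ambigOne S ω j) *
          ∑ i, ∑ j, ambigZero S ω i * ambigOne S ω j *
            (if D (obs b σ v S ω) ≠ chi S then 1 else 0))
      + ∑ S ∈ powersetCard s (univ : Finset (Fin d)), ∑ ω : Fin d → Fin 3,
        configWeight p q ω * (g (∑ i, ambigZero S ω i) (∑ j, ambigOne S ω j) *
          ∑ i, ∑ j, ambigZero S ω i * ambigOne S ω j *
            (if D (obs b σ v S ω) ≠ chi (S.map (Equiv.swap i j).toEmbedding)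
              then 1 else 0)) := by
    rw [← Finset.sum_add_distrib]
    refine Finset.sum_le_sum fun S _ => ?_
    rw [← Finset.sum_add_distrib]
    refine Finset.sum_le_sum fun ω _ => ?_
    rw [← mul_add]
    refine mul_le_mul_of_nonneg_left ?_ (configWeight_nonneg hp hq hpq ω)
    have := h1 S ω 1
    rw [mul_one] at this
    rw [← this, ← mul_add]
    refine mul_le_mul_of_nonneg_left ?_ ?_
    · rw [← Finset.sum_add_distrib]
      refine Finset.sum_le_sum fun i _ => ?_
      rw [← Finset.sum_add_distrib]
      refine Finset.sum_le_sum fun j _ => ?_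
      rw [← mul_add]
      by_cases hij : (i ∉ S ∧ ω i = 1) ∧ (j ∈ S ∧ ω j = 2)
      · refine mul_le_mul_of_nonneg_left ?_
          (mul_nonneg (ambigZero_nonneg S ω i) (ambigOne_nonneg S ω j))
        have hne : S ≠ S.map (Equiv.swap i j).toEmbedding := by
          intro h
          have hi := hij.1.1
          rw [h, Finset.mem_map_equiv, Equiv.symm_swap, Equiv.swap_apply_left] at hi
          exact hi hij.2.1
        by_cases hD : D (obs b σ v S ω) = chi S
        · have : D (obs b σ v S ω) ≠ chi (S.map (Equiv.swap i j).toEmbedding) := by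
            rw [hD]; exact fun h => hne (chi_injective h)
          simp only [if_pos this]
          split_ifs <;> norm_num
        · simp [hD]
          split_ifs <;> norm_num
      · have : ambigZero S ω i * ambigOne S ω j = 0 := by
          unfold ambigZero ambigOne
          split_ifs <;> simp_all
        rw [this]; simp
    · exact inv_nonneg.2 (mul_nonneg (Finset.sum_nonneg fun i _ => ambigZero_nonneg S ω i)
        (Finset.sum_nonneg fun i _ => ambigOne_nonneg S ω i))
  have h3 : ∑ S ∈ powersetCard s (univ : Finset (Fin d)), ∑ ω : Fin d → Fin 3,
        configWeight p q ω * (g (∑ i, ambigZero S ω i) (∑ j, ambigOne S ω j) *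
          ∑ i, ∑ j, ambigZero S ω i * ambigOne S ω j *
            (if D (obs b σ v S ω) ≠ chi S then 1 else 0))
      ≤ ∑ S ∈ powersetCard s (univ : Finset (Fin d)), ∑ ω : Fin d → Fin 3,
          configWeight p q ω * (if D (obs b σ v S ω) ≠ chi S then 1 else 0) := by
    refine Finset.sum_le_sum fun S _ => Finset.sum_le_sum fun ω _ => ?_
    refine mul_le_mul_of_nonneg_left ?_ (configWeight_nonneg hp hq hpq ω)
    rw [h1]
    split_ifs <;> norm_num
  have h4 : ((powersetCard s (univ : Finset (Fin d))).card : ℝ) *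
        (1 - (1 - p) ^ (d - s) - (1 - q) ^ s)
      ≤ ∑ S ∈ powersetCard s (univ : Finset (Fin d)), ∑ ω : Fin d → Fin 3,
      configWeight p q ω *
        (if (∑ i, ambigZero S ω i) * (∑ j, ambigOne S ω j) = 0 then 0 else 1) := by
    rw [← nsmul_eq_mul]
    refine Finset.card_nsmul_le_sum _ _ _ fun S hS => ?_
    exact one_sub_le_ambig (Finset.mem_powersetCard.1 hS).2 hp hq hpq
  change ∑ S ∈ powersetCard s (univ : Finset (Fin d)), ∑ ω : Fin d → Fin 3,
        configWeight p q ω * _ = ∑ S ∈ powersetCard s (univ : Finset (Fin d)),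
        ∑ ω : Fin d → Fin 3, configWeight p q ω * _ at key
  rw [← key] at h2
  linarith

theorem sum_weight_pair {d : ℕ} (p q : ℝ) (S : Finset (Fin d)) (i j : Fin d) :
    ∑ ω : Fin d → Fin 3, configWeight p q ω * (ambigZero S ω i * ambigOne S ω j)
      = (if i ∉ S then 1 else 0) * (if j ∈ S then 1 else 0) * (p * q) := by
  by_cases hi : i ∈ S
  · simp [ambigZero, hi]
  by_cases hj : j ∈ S
  swap
  · simp [ambigOne, hj]
  have hij : i ≠ j := by rintro rfl; exact hi hj
  have h := sum_prod_mul_prod (threeWeight p q) (sum_threeWeight p q) {i, j}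
    fun k t => if t = (if k = i then 1 else 2) then 1 else 0
  rw [Finset.prod_pair hij] at h
  simp only [Finset.prod_pair hij, if_true, if_neg hij.symm] at h
  have h1 : ∑ t, threeWeight p q t * (if t = 1 then 1 else 0) = p := by
    simp [threeWeight]
  have h2 : ∑ t, threeWeight p q t * (if t = 2 then 1 else 0) = q := by
    simp [threeWeight]
  rw [h1, h2] at h
  simpa [ambigZero, ambigOne, hi, hj, configWeight] using h

theorem sum_weight_triple {d : ℕ} (p q : ℝ) (S : Finset (Fin d)) {i i' : Fin d} (j : Fin d)
    (hii : i ≠ i') :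
    ∑ ω : Fin d → Fin 3,
        configWeight p q ω * (ambigZero S ω i * ambigZero S ω i' * ambigOne S ω j)
      = (if i ∉ S then 1 else 0) * (if i' ∉ S then 1 else 0) * (if j ∈ S then 1 else 0)
        * (p * p * q) := by
  by_cases hi : i ∈ S
  · simp [ambigZero, hi]
  by_cases hi' : i' ∈ S
  · simp [ambigZero, hi']
  by_cases hj : j ∈ S
  swap
  · simp [ambigOne, hj]
  have hij : i ≠ j := by rintro rfl; exact hi hj
  have hij' : i' ≠ j := by rintro rfl; exact hi' hj
  have h := sum_prod_mul_prod (threeWeight p q) (sum_threeWeight p q) {i, i', j}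
    fun k t => if t = (if k = j then 2 else 1) then 1 else 0
  have hn1 : i ∉ ({i', j} : Finset (Fin d)) := by simp [hii, hij]
  simp only [Finset.prod_insert hn1, Finset.prod_pair hij', if_true, if_neg hij,
    if_neg hij'] at h
  have h1 : ∑ t, threeWeight p q t * (if t = 1 then 1 else 0) = p := by
    simp [threeWeight]
  have h2 : ∑ t, threeWeight p q t * (if t = 2 then 1 else 0) = q := by
    simp [threeWeight]
  rw [h1, h2] at h
  simp only [← mul_assoc] at h ⊢
  simpa [ambigZero, ambigOne, hi, hi', hj, configWeight] using h

theorem sum_ite_mem_eq_card {d : ℕ} (S : Finset (Fin d)) :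
    ∑ k, (if k ∈ S then (1 : ℝ) else 0) = S.card := by simp

theorem sum_ite_notMem_eq_card {d : ℕ} (S : Finset (Fin d)) :
    ∑ k, (if k ∉ S then (1 : ℝ) else 0) = (d : ℝ) - S.card := by
  have h : ∑ k, (if k ∉ S then (1 : ℝ) else 0)
      = ∑ k : Fin d, (1 - (if k ∈ S then (1 : ℝ) else 0)) :=
    Finset.sum_congr rfl fun k _ => by split_ifs <;> simp_all
  rw [h, Finset.sum_sub_distrib, sum_ite_mem_eq_card]
  simp

theorem moment_one_one {d : ℕ} (p q : ℝ) (S : Finset (Fin d)) :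
    ∑ ω : Fin d → Fin 3,
        configWeight p q ω * ((∑ i, ambigZero S ω i) * ∑ j, ambigOne S ω j)
      = ((d : ℝ) - S.card) * S.card * (p * q) := by
  simp_rw [Finset.sum_mul_sum, Finset.mul_sum]
  rw [Finset.sum_comm]
  simp_rw [Finset.sum_comm (s := (univ : Finset (Fin d → Fin 3))), sum_weight_pair]
  rw [← sum_ite_notMem_eq_card S, ← sum_ite_mem_eq_card S, Finset.sum_mul_sum, Finset.sum_mul]
  exact Finset.sum_congr rfl fun i _ => by rw [Finset.sum_mul]

theorem moment_two_one_le {d : ℕ} {p q : ℝ} (hp : 0 ≤ p) (hq : 0 ≤ q) (S : Finset (Fin d)) :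
    ∑ ω : Fin d → Fin 3, configWeight p q ω *
        ((∑ i, ambigZero S ω i) * (∑ i, ambigZero S ω i) * ∑ j, ambigOne S ω j)
      ≤ ((d : ℝ) - S.card) * ((d : ℝ) - S.card) * S.card * (p * p * q)
        + ((d : ℝ) - S.card) * S.card * (p * q) := by
  have h1 : ∑ ω : Fin d → Fin 3, configWeight p q ω *
        ((∑ i, ambigZero S ω i) * (∑ i, ambigZero S ω i) * ∑ j, ambigOne S ω j)
      = ∑ i, ∑ i', ∑ j, ∑ ω : Fin d → Fin 3,
        configWeight p q ω * (ambigZero S ω i * ambigZero S ω i' * ambigOne S ω j) := by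
    simp_rw [Finset.sum_mul_sum, Finset.sum_mul, Finset.mul_sum]
    rw [Finset.sum_comm]
    refine Finset.sum_congr rfl fun i _ => ?_
    rw [Finset.sum_comm, Finset.sum_comm (s := (univ : Finset (Fin d)))
      (t := (univ : Finset (Fin d)))]
    exact Finset.sum_congr rfl fun j _ => Finset.sum_comm
  have h2 : ∀ i i' j, ∑ ω : Fin d → Fin 3,
        configWeight p q ω * (ambigZero S ω i * ambigZero S ω i' * ambigOne S ω j)
      ≤ (if i ∉ S then 1 else 0) * (if i' ∉ S then 1 else 0) * (if j ∈ S then 1 else 0)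
        * (p * p * q)
        + (if i = i' then (if i ∉ S then 1 else 0) * (if j ∈ S then 1 else 0) * (p * q)
            else 0) := by
    intro i i' j
    by_cases hii : i = i'
    · subst hii
      have hsq : ∀ ω, ambigZero S ω i * ambigZero S ω i = ambigZero S ω i := by
        intro ω; unfold ambigZero; split_ifs <;> norm_num
      simp_rw [hsq]
      rw [sum_weight_pair]
      rw [if_pos trivial]
      refine le_add_of_nonneg_left ?_
      have : 0 ≤ p * p * q := by positivity
      split_ifs <;> simp [this]
    · rw [sum_weight_triple p q S j hii, if_neg hii, add_zero]
  rw [h1]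
  refine (Finset.sum_le_sum fun i _ => Finset.sum_le_sum fun i' _ =>
    Finset.sum_le_sum fun j _ => h2 i i' j).trans (le_of_eq ?_)
  simp_rw [Finset.sum_add_distrib]
  congr 1
  · rw [← sum_ite_notMem_eq_card S, ← sum_ite_mem_eq_card S]
    rw [Finset.sum_mul_sum, Finset.sum_mul, Finset.sum_mul]
    refine Finset.sum_congr rfl fun i _ => ?_
    rw [Finset.sum_mul, Finset.sum_mul]
    refine Finset.sum_congr rfl fun i' _ => ?_
    rw [Finset.mul_sum, Finset.sum_mul]
  · have h3 : ∀ i : Fin d, ∑ i' : Fin d, ∑ j : Fin d,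
        (if i = i' then (if i ∉ S then (1 : ℝ) else 0) * (if j ∈ S then 1 else 0) * (p * q)
            else 0)
        = ∑ j : Fin d, (if i ∉ S then (1 : ℝ) else 0) * (if j ∈ S then 1 else 0) * (p * q) := by
      intro i
      rw [Finset.sum_comm]
      simp
    simp_rw [h3]
    rw [← sum_ite_notMem_eq_card S, ← sum_ite_mem_eq_card S, Finset.sum_mul_sum, Finset.sum_mul]
    exact Finset.sum_congr rfl fun i _ => by rw [Finset.sum_mul]

theorem hamming_eq_sum {d : ℕ} (a b : Fin d → Bool) :
    (hamming a b : ℝ) = ∑ k, if a k ≠ b k then (1 : ℝ) else 0 := by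
  unfold hamming
  rw [Finset.card_filter]
  push_cast
  exact Finset.sum_congr rfl fun k _ => by split_ifs <;> rfl

theorem moment_lower {d s : ℕ} (hs : 1 ≤ s) {p q : ℝ} (hq : 0 ≤ q) (hp : 0 ≤ p)
    (hps : ((d : ℝ) - s) * p = 2 * s) {S : Finset (Fin d)} (hcard : S.card = s) :
    (s * q / 2 : ℝ) ≤ ∑ ω : Fin d → Fin 3, configWeight p q ω *
      ((1 / s - (∑ i, ambigZero S ω i) / (4 * (s : ℝ) ^ 2)) *
        ((∑ i, ambigZero S ω i) * (∑ j, ambigOne S ω j))) := by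
  have hs0 : (1 : ℝ) ≤ s := by exact_mod_cast hs
  have hspos : (0 : ℝ) < s := by linarith
  have hm1 := moment_one_one p q S
  have hm2 := moment_two_one_le hp hq S
  rw [hcard] at hm1 hm2
  have heq : ∑ ω : Fin d → Fin 3,
      configWeight p q ω * ((1 / s - (∑ i, ambigZero S ω i) / (4 * (s : ℝ) ^ 2)) *
        ((∑ i, ambigZero S ω i) * (∑ j, ambigOne S ω j)))
      = (∑ ω : Fin d → Fin 3,
          configWeight p q ω * ((∑ i, ambigZero S ω i) * ∑ j, ambigOne S ω j)) * (1 / s)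
        - (∑ ω : Fin d → Fin 3, configWeight p q ω *
          ((∑ i, ambigZero S ω i) * (∑ i, ambigZero S ω i) * ∑ j, ambigOne S ω j))
          * (1 / (4 * s ^ 2)) := by
    rw [Finset.sum_mul, Finset.sum_mul, ← Finset.sum_sub_distrib]
    refine Finset.sum_congr rfl fun ω _ => ?_
    field_simp
  rw [heq]
  have e1 : ((d : ℝ) - s) * s * (p * q) = 2 * s ^ 2 * q := by
    linear_combination (s * q) * hps
  have e2 : ((d : ℝ) - s) * ((d : ℝ) - s) * s * (p * p * q) = 4 * s ^ 3 * q := by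
    linear_combination (s * q * (((d : ℝ) - s) * p + 2 * s)) * hps
  rw [hm1, e1]
  rw [e1, e2] at hm2
  have h5 := mul_le_mul_of_nonneg_right hm2
    (show (0 : ℝ) ≤ 1 / (4 * s ^ 2) by positivity)
  have e3 : (4 * (s : ℝ) ^ 3 * q + 2 * s ^ 2 * q) * (1 / (4 * s ^ 2)) = s * q + q / 2 := by
    field_simp; ring
  have e4 : 2 * (s : ℝ) ^ 2 * q * (1 / s) = 2 * s * q := by field_simp
  rw [e3] at h5
  rw [e4]
  have h6 : q ≤ s * q := le_mul_of_one_le_left hq hs0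
  linarith

theorem hamming_average {d s : ℕ} (hs : 1 ≤ s) {b σ : ℝ} {v : Fin 3 → ℝ}
    (hv : σ * v 1 = b + σ * v 2)
    {p q : ℝ} (hp : 0 ≤ p) (hq : 0 ≤ q) (hpq : p + q ≤ 1) (hps : ((d : ℝ) - s) * p = 2 * s)
    (D : (Fin d → ℝ) → Fin d → Bool) :
    ((powersetCard s (univ : Finset (Fin d))).card : ℝ) * (s * q / 2)
      ≤ ∑ S ∈ powersetCard s (univ : Finset (Fin d)), ∑ ω : Fin d → Fin 3,
          configWeight p q ω * (hamming (D (obs b σ v S ω)) (chi S) : ℝ) := by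
  have hs0 : (1 : ℝ) ≤ s := by exact_mod_cast hs
  have hspos : (0 : ℝ) < s := by linarith
  set g : ℝ → ℝ → ℝ := fun x _ => 1 / s - x / (4 * s ^ 2) with hg
  set er : Fin d → (Fin d → ℝ) → Finset (Fin d) → ℝ :=
    fun k X S => if D X k ≠ chi S k then 1 else 0 with her
  have her0 : ∀ k X S, 0 ≤ er k X S := by
    intro k X S; simp only [her]; split_ifs <;> norm_num
  have key := sum_swap s hv (threeWeight p q) g fun i j X S => er i X S + er j X S
  change ∑ S ∈ powersetCard s (univ : Finset (Fin d)), ∑ ω : Fin d → Fin 3,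
        configWeight p q ω * _ = ∑ S ∈ powersetCard s (univ : Finset (Fin d)),
        ∑ ω : Fin d → Fin 3, configWeight p q ω * _ at key
  have hsum : ∑ S ∈ powersetCard s (univ : Finset (Fin d)), ∑ ω : Fin d → Fin 3,
        configWeight p q ω * (g (∑ i, ambigZero S ω i) (∑ j, ambigOne S ω j) *
          ∑ i, ∑ j, ambigZero S ω i * ambigOne S ω j *
            (er i (obs b σ v S ω) S + er j (obs b σ v S ω) S))
      + ∑ S ∈ powersetCard s (univ : Finset (Fin d)), ∑ ω : Fin d → Fin 3,
        configWeight p q ω * (g (∑ i, ambigZero S ω i) (∑ j, ambigOne S ω j) *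
          ∑ i, ∑ j, ambigZero S ω i * ambigOne S ω j *
            (er j (obs b σ v S ω) (S.map (Equiv.swap i j).toEmbedding)
              + er i (obs b σ v S ω) (S.map (Equiv.swap i j).toEmbedding)))
      = 2 * ∑ S ∈ powersetCard s (univ : Finset (Fin d)), ∑ ω : Fin d → Fin 3,
        configWeight p q ω * (g (∑ i, ambigZero S ω i) (∑ j, ambigOne S ω j) *
          ((∑ i, ambigZero S ω i) * (∑ j, ambigOne S ω j))) := by
    rw [← Finset.sum_add_distrib, Finset.mul_sum]
    refine Finset.sum_congr rfl fun S _ => ?_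
    rw [← Finset.sum_add_distrib, Finset.mul_sum]
    refine Finset.sum_congr rfl fun ω _ => ?_
    rw [← mul_add, ← mul_add, mul_left_comm 2, mul_left_comm 2]
    congr 2
    rw [← Finset.sum_add_distrib, Finset.sum_mul_sum, Finset.mul_sum]
    refine Finset.sum_congr rfl fun i _ => ?_
    rw [← Finset.sum_add_distrib, Finset.mul_sum]
    refine Finset.sum_congr rfl fun j _ => ?_
    rw [← mul_add, mul_comm 2]
    by_cases hij : (i ∉ S ∧ ω i = 1) ∧ (j ∈ S ∧ ω j = 2)
    · congr 1
      have h1 : chi (S.map (Equiv.swap i j).toEmbedding) i = true := by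
        simp only [chi, decide_eq_true_eq]
        rw [Finset.mem_map_equiv, Equiv.symm_swap, Equiv.swap_apply_left]
        exact hij.2.1
      have h2 : chi (S.map (Equiv.swap i j).toEmbedding) j = false := by
        simp only [chi, decide_eq_false_iff_not]
        rw [Finset.mem_map_equiv, Equiv.symm_swap, Equiv.swap_apply_right]
        exact hij.1.1
      have h3 : chi S i = false := by simp [chi, hij.1.1]
      have h4 : chi S j = true := by simp [chi, hij.2.1]
      simp only [her, h1, h2, h3, h4]
      cases D (obs b σ v S ω) i <;> cases D (obs b σ v S ω) j <;> norm_num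
    · have : ambigZero S ω i * ambigOne S ω j = 0 := by
        unfold ambigZero ambigOne
        split_ifs <;> simp_all
      rw [this]; simp
  have hupper : ∑ S ∈ powersetCard s (univ : Finset (Fin d)), ∑ ω : Fin d → Fin 3,
        configWeight p q ω * (g (∑ i, ambigZero S ω i) (∑ j, ambigOne S ω j) *
          ∑ i, ∑ j, ambigZero S ω i * ambigOne S ω j *
            (er i (obs b σ v S ω) S + er j (obs b σ v S ω) S))
      ≤ ∑ S ∈ powersetCard s (univ : Finset (Fin d)), ∑ ω : Fin d → Fin 3,
          configWeight p q ω * (hamming (D (obs b σ v S ω)) (chi S) : ℝ) := by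
    refine Finset.sum_le_sum fun S hS => Finset.sum_le_sum fun ω _ => ?_
    refine mul_le_mul_of_nonneg_left ?_ (configWeight_nonneg hp hq hpq ω)
    have hcard : S.card = s := (Finset.mem_powersetCard.1 hS).2
    rw [hamming_eq_sum]
    change _ ≤ ∑ k, er k (obs b σ v S ω) S
    set X := obs b σ v S ω
    set n0 := ∑ i, ambigZero S ω i with hn0
    set n1 := ∑ j, ambigOne S ω j with hn1
    have hfact : ∑ i, ∑ j, ambigZero S ω i * ambigOne S ω j * (er i X S + er j X S)
        = (∑ i, ambigZero S ω i * er i X S) * n1 + n0 * ∑ j, ambigOne S ω j * er j X S := by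
      rw [hn0, hn1, Finset.sum_mul_sum, Finset.sum_mul_sum, ← Finset.sum_add_distrib]
      refine Finset.sum_congr rfl fun i _ => ?_
      rw [← Finset.sum_add_distrib]
      exact Finset.sum_congr rfl fun j _ => by ring
    have hE0 : 0 ≤ ∑ i, ambigZero S ω i * er i X S :=
      Finset.sum_nonneg fun i _ => mul_nonneg (ambigZero_nonneg S ω i) (her0 _ _ _)
    have hE1 : 0 ≤ ∑ j, ambigOne S ω j * er j X S :=
      Finset.sum_nonneg fun i _ => mul_nonneg (ambigOne_nonneg S ω i) (her0 _ _ _)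
    have hEle : ∑ i, ambigZero S ω i * er i X S + ∑ j, ambigOne S ω j * er j X S
        ≤ ∑ k, er k X S := by
      rw [← Finset.sum_add_distrib]
      refine Finset.sum_le_sum fun k _ => ?_
      rw [← add_mul]
      refine mul_le_of_le_one_left (her0 _ _ _) ?_
      unfold ambigZero ambigOne
      split_ifs <;> simp_all
    have hn0' : 0 ≤ n0 := Finset.sum_nonneg fun i _ => ambigZero_nonneg S ω i
    have hn1' : 0 ≤ n1 := Finset.sum_nonneg fun i _ => ambigOne_nonneg S ω i
    have hn1s : n1 ≤ s := by
      rw [← hcard, ← sum_ite_mem_eq_card S]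
      exact Finset.sum_le_sum fun j _ => ambigOne_le S ω j
    have hg1 : g n0 n1 * n1 ≤ 1 := by
      have h1 : g n0 n1 ≤ 1 / s := by
        simp only [hg]
        have : 0 ≤ n0 / (4 * (s : ℝ) ^ 2) := by positivity
        linarith
      calc g n0 n1 * n1 ≤ 1 / s * n1 := mul_le_mul_of_nonneg_right h1 hn1'
        _ ≤ 1 / s * s := mul_le_mul_of_nonneg_left hn1s (by positivity)
        _ = 1 := by field_simp
    have hg0 : g n0 n1 * n0 ≤ 1 := by
      have : 1 - g n0 n1 * n0 = (n0 / (2 * s) - 1) ^ 2 := by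
        simp only [hg]; field_simp; ring
      nlinarith [sq_nonneg (n0 / (2 * s) - 1)]
    rw [hfact]
    nlinarith [mul_le_mul_of_nonneg_left hg1 hE0, mul_le_mul_of_nonneg_left hg0 hE1]
  have hlower : ((powersetCard s (univ : Finset (Fin d))).card : ℝ) * (s * q / 2)
      ≤ ∑ S ∈ powersetCard s (univ : Finset (Fin d)), ∑ ω : Fin d → Fin 3,
        configWeight p q ω * (g (∑ i, ambigZero S ω i) (∑ j, ambigOne S ω j) *
          ((∑ i, ambigZero S ω i) * (∑ j, ambigOne S ω j))) := by
    rw [← nsmul_eq_mul]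
    refine Finset.card_nsmul_le_sum _ _ _ fun S hS => ?_
    have hcard : S.card = s := (Finset.mem_powersetCard.1 hS).2
    exact moment_lower hs hq hp hps hcard
  rw [← key] at hsum
  linarith

/-- The three point distribution as a measure on labels. -/
def labelLaw (p q : ℝ) : Measure (Fin 3) :=
  ∑ t, ENNReal.ofReal (threeWeight p q t) • Measure.dirac t

theorem labelLaw_apply (p q : ℝ) (A : Set (Fin 3)) :
    labelLaw p q A = ∑ t, if t ∈ A then ENNReal.ofReal (threeWeight p q t) else 0 := by
  simp [labelLaw, Measure.finsetSum_apply, Set.indicator_apply]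

theorem isProbabilityMeasure_labelLaw {p q : ℝ} (hp : 0 ≤ p) (hq : 0 ≤ q) (hpq : p + q ≤ 1) :
    IsProbabilityMeasure (labelLaw p q) := by
  constructor
  rw [labelLaw_apply]
  simp only [Set.mem_univ, if_true]
  rw [← ENNReal.ofReal_sum_of_nonneg fun t _ => threeWeight_nonneg hp hq hpq t,
    sum_threeWeight, ENNReal.ofReal_one]

/-- The law of a noise variable taking the values `v 0`, `v 1`, `v 2`. -/
def noiseLaw (p q : ℝ) (v : Fin 3 → ℝ) : Measure ℝ := (labelLaw p q).map v

theorem noiseLaw_toReal {p q : ℝ} (hp : 0 ≤ p) (hq : 0 ≤ q) (hpq : p + q ≤ 1) (v : Fin 3 → ℝ)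
    {A : Set ℝ} (hA : MeasurableSet A) :
    (noiseLaw p q v A).toReal = ∑ t, if v t ∈ A then threeWeight p q t else 0 := by
  rw [noiseLaw, Measure.map_apply (measurable_of_finite v) hA, labelLaw_apply,
    ENNReal.toReal_sum]
  · refine Finset.sum_congr rfl fun t _ => ?_
    simp only [Set.mem_preimage]
    split_ifs
    · exact ENNReal.toReal_ofReal (threeWeight_nonneg hp hq hpq t)
    · rfl
  · intro t _
    split_ifs <;> simp

theorem noiseLaw_mem_Pclass {ν p q t₁ t₂ : ℝ} (hν : 0 < ν) (hp : 0 ≤ p) (hq : 0 ≤ q)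
    (hpq : p + q ≤ 1) (ht₁ : 0 ≤ t₁) (ht₂ : 0 ≤ t₂) (h₁ : p ≤ Real.exp (-(t₁ ^ ν) / ν))
    (h₂ : q ≤ Real.exp (-(t₂ ^ ν) / ν)) :
    noiseLaw p q ![0, t₁, -t₂] ∈ Pclass ν := by
  have hP := isProbabilityMeasure_labelLaw hp hq hpq
  have hmono : ∀ u t : ℝ, 0 ≤ u → u ≤ t →
      Real.exp (-(t ^ ν) / ν) ≤ Real.exp (-(u ^ ν) / ν) := by
    intro u t hu hut
    have := Real.rpow_le_rpow hu hut hν.le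
    gcongr
  have hprob : IsProbabilityMeasure (noiseLaw p q ![0, t₁, -t₂]) :=
    Measure.isProbabilityMeasure_map (measurable_of_finite _).aemeasurable
  refine ⟨hprob, fun u hu => ⟨?_, ?_⟩⟩
  · rw [noiseLaw_toReal hp hq hpq _ measurableSet_Ioi, Fin.sum_univ_three]
    have e0 : ¬ u < 0 := not_lt.2 hu
    have e2 : ¬ u < -t₂ := by linarith
    simp only [Set.mem_Ioi, threeWeight, Matrix.cons_val_zero, Matrix.cons_val_one,
      Matrix.cons_val, e0, e2, if_false, zero_add, add_zero]
    split_ifs with h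
    · exact h₁.trans (hmono u t₁ hu h.le)
    · positivity
  · rcases hu.eq_or_lt with rfl | hu'
    · rw [Real.zero_rpow hν.ne']
      have h : (noiseLaw p q ![0, t₁, -t₂]).real (Set.Iic 0) ≤ 1 := measureReal_le_one
      rwa [neg_zero, zero_div, Real.exp_zero]
    · rw [noiseLaw_toReal hp hq hpq _ measurableSet_Iic, Fin.sum_univ_three]
      have e0 : ¬ (0 : ℝ) ≤ -u := by linarith
      have e1 : ¬ t₁ ≤ -u := by linarith
      simp only [Set.mem_Iic, threeWeight, Matrix.cons_val_zero, Matrix.cons_val_one,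
        Matrix.cons_val, e0, e1, if_false, zero_add]
      split_ifs with h
      · exact h₂.trans (hmono u t₂ hu (by linarith))
      · positivity

theorem integral_Ploc_noiseLaw {d : ℕ} {p q : ℝ} (hp : 0 ≤ p) (hq : 0 ≤ q) (hpq : p + q ≤ 1)
    (σ b : ℝ) (v : Fin 3 → ℝ) (S : Finset (Fin d)) {f : (Fin d → ℝ) → ℝ} (hf : Measurable f) :
    ∫ X, f X ∂(Ploc σ (noiseLaw p q v) fun k => if k ∈ S then b else 0)
      = ∑ ω : Fin d → Fin 3, configWeight p q ω * f (obs b σ v S ω) := by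
  have hP := isProbabilityMeasure_labelLaw hp hq hpq
  have h1 : Ploc σ (noiseLaw p q v) (fun k : Fin d => if k ∈ S then b else 0)
      = (Measure.pi fun _ : Fin d => labelLaw p q).map (obs b σ v S) := by
    have h2 : ∀ i : Fin d, (noiseLaw p q v).map
        (fun x => (if i ∈ S then b else 0) + σ * x)
        = (labelLaw p q).map (fun t => (if i ∈ S then b else 0) + σ * v t) := by
      intro i
      rw [noiseLaw, Measure.map_map (by fun_prop) (measurable_of_finite v)]
      rfl
    have hS : ∀ i : Fin d, SigmaFinite ((labelLaw p q).map
        (fun t => (if i ∈ S then b else 0) + σ * v t)) := by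
      intro i
      have := Measure.isProbabilityMeasure_map (μ := labelLaw p q)
        (f := fun t => (if i ∈ S then b else 0) + σ * v t)
        (measurable_of_finite _).aemeasurable
      infer_instance
    unfold Ploc
    simp_rw [h2]
    rw [← Measure.pi_map_pi fun i => (measurable_of_finite _).aemeasurable]
    rfl
  rw [h1, integral_map (measurable_of_finite _).aemeasurable hf.aestronglyMeasurable,
    integral_fintype Integrable.of_finite]
  refine Finset.sum_congr rfl fun ω _ => ?_
  rw [smul_eq_mul, Measure.real, Measure.pi_singleton, ENNReal.toReal_prod]
  congr 1
  refine Finset.prod_congr rfl fun k _ => ?_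
  rw [labelLaw_apply]
  simp [ENNReal.toReal_ofReal (threeWeight_nonneg hp hq hpq (ω k))]

theorem isProbabilityMeasure_Ploc {ν : ℝ} (σ : ℝ) {d : ℕ} (Q : Pclass ν) (μ : Fin d → ℝ) :
    IsProbabilityMeasure (Ploc σ Q.1 μ) := by
  have := Q.2.1
  have : ∀ i, IsProbabilityMeasure (Q.1.map fun x => μ i + σ * x) := fun i =>
    Measure.isProbabilityMeasure_map (by fun_prop)
  unfold Ploc
  infer_instance

theorem abs_integral_le {α : Type*} [MeasurableSpace α] (μ : Measure α)
    [IsProbabilityMeasure μ] {f : α → ℝ} {M : ℝ} (hf : ∀ x, |f x| ≤ M) : |∫ x, f x ∂μ| ≤ M := by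
  have h := norm_integral_le_of_norm_le_const (μ := μ) (f := f) (C := M)
    (ae_of_all _ fun x => by simpa using hf x)
  simpa using h

/-- Maximal risk of the randomized selector `sel` for the loss `ℓ`. -/
def maxRisk (ν σ : ℝ) (d s : ℕ) (a : ℝ) {Z : Type} [MeasurableSpace Z] (ζ : Measure Z)
    (sel : (Fin d → ℝ) → Z → Fin d → Bool) (ℓ : (Fin d → Bool) → (Fin d → Bool) → ℝ) : ℝ :=
  ⨆ Q : Pclass ν, ⨆ μ : ThetaLoc d s a,
    ∫ z, ∫ X, ℓ (sel X z) (etaOf μ.1) ∂(Ploc σ Q.1 μ.1) ∂ζ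

section
variable {ν σ : ℝ} {d s : ℕ} {a : ℝ} {Z : Type} [MeasurableSpace Z] {ζ : Measure Z}
  [IsProbabilityMeasure ζ] {sel : (Fin d → ℝ) → Z → Fin d → Bool}
  {ℓ : (Fin d → Bool) → (Fin d → Bool) → ℝ} {M : ℝ}

theorem risk_le (hℓ : ∀ x y, |ℓ x y| ≤ M) (Q : Pclass ν) (μ : Fin d → ℝ) :
    ∫ z, ∫ X, ℓ (sel X z) (etaOf μ) ∂(Ploc σ Q.1 μ) ∂ζ ≤ M := by
  have := isProbabilityMeasure_Ploc σ Q μ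
  exact (le_abs_self _).trans
    (abs_integral_le ζ fun z => abs_integral_le _ fun X => hℓ _ _)

theorem nonneg_of_loss_bound (hℓ : ∀ x y, |ℓ x y| ≤ M) : 0 ≤ M :=
  (abs_nonneg (ℓ (fun _ => true) (fun _ => true))).trans (hℓ _ _)

theorem iSup_risk_le (hℓ : ∀ x y, |ℓ x y| ≤ M) (Q : Pclass ν) :
    ⨆ μ : ThetaLoc d s a, ∫ z, ∫ X, ℓ (sel X z) (etaOf μ.1) ∂(Ploc σ Q.1 μ.1) ∂ζ ≤ M :=
  Real.iSup_le (fun μ => risk_le hℓ Q μ.1) (nonneg_of_loss_bound hℓ)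

theorem bddAbove_risk (hℓ : ∀ x y, |ℓ x y| ≤ M) (Q : Pclass ν) :
    BddAbove (Set.range fun μ : ThetaLoc d s a =>
      ∫ z, ∫ X, ℓ (sel X z) (etaOf μ.1) ∂(Ploc σ Q.1 μ.1) ∂ζ) :=
  ⟨M, by rintro _ ⟨μ, rfl⟩; exact risk_le hℓ Q μ.1⟩

theorem bddAbove_iSup_risk (hℓ : ∀ x y, |ℓ x y| ≤ M) :
    BddAbove (Set.range fun Q : Pclass ν => ⨆ μ : ThetaLoc d s a,
      ∫ z, ∫ X, ℓ (sel X z) (etaOf μ.1) ∂(Ploc σ Q.1 μ.1) ∂ζ) :=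
  ⟨M, by rintro _ ⟨Q, rfl⟩; exact iSup_risk_le hℓ Q⟩

theorem risk_le_maxRisk (hℓ : ∀ x y, |ℓ x y| ≤ M) (Q : Pclass ν) (μ : ThetaLoc d s a) :
    ∫ z, ∫ X, ℓ (sel X z) (etaOf μ.1) ∂(Ploc σ Q.1 μ.1) ∂ζ ≤ maxRisk ν σ d s a ζ sel ℓ :=
  (le_ciSup (bddAbove_risk hℓ Q) μ).trans (le_ciSup (bddAbove_iSup_risk hℓ) Q)

theorem le_maxRisk_of_average (hℓ : ∀ x y, |ℓ x y| ≤ M) (hsel : Measurable (Function.uncurry sel))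
    (hsd : s ≤ d) {b : ℝ} (hb : 0 < b) (hab : a ≤ b) {p q : ℝ} (hp : 0 ≤ p) (hq : 0 ≤ q)
    (hpq : p + q ≤ 1) {v : Fin 3 → ℝ} (hQ : noiseLaw p q v ∈ Pclass ν) {C : ℝ}
    (hC : ∀ D : (Fin d → ℝ) → Fin d → Bool,
      ((powersetCard s (univ : Finset (Fin d))).card : ℝ) * C
        ≤ ∑ S ∈ powersetCard s (univ : Finset (Fin d)), ∑ ω : Fin d → Fin 3,
          configWeight p q ω * ℓ (D (obs b σ v S ω)) (chi S)) :
    C ≤ maxRisk ν σ d s a ζ sel ℓ := by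
  have hmem : ∀ S ∈ powersetCard s (univ : Finset (Fin d)),
      (fun k => if k ∈ S then b else 0) ∈ ThetaLoc d s a := by
    intro S hS
    refine ⟨S, (Finset.mem_powersetCard.1 hS).2, fun j hj => ?_, fun j hj => ?_⟩
    · simpa [hj] using hab
    · simp [hj]
  have heta : ∀ S : Finset (Fin d), etaOf (fun k => if k ∈ S then b else 0) = chi S := by
    intro S
    funext k
    by_cases hk : k ∈ S <;> simp [etaOf, chi, hk, hb.ne']
  have hmeasX : ∀ y z, Measurable fun X => ℓ (sel X z) y := fun y z =>
    (measurable_of_finite fun x => ℓ x y).comp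
      (hsel.comp (measurable_id.prodMk measurable_const))
  have hmeasZ : ∀ y X, Measurable fun z => ℓ (sel X z) y := fun y X =>
    (measurable_of_finite fun x => ℓ x y).comp
      (hsel.comp (measurable_const.prodMk measurable_id))
  have hint : ∀ y X, Integrable (fun z => ℓ (sel X z) y) ζ := fun y X =>
    Integrable.of_bound (hmeasZ y X).aestronglyMeasurable M (ae_of_all _ fun z => hℓ _ _)
  have hS : ∀ S ∈ powersetCard s (univ : Finset (Fin d)),
      ∫ z, ∑ ω : Fin d → Fin 3, configWeight p q ω * ℓ (sel (obs b σ v S ω) z) (chi S) ∂ζ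
        ≤ maxRisk ν σ d s a ζ sel ℓ := by
    intro S hS
    have h := risk_le_maxRisk (σ := σ) (ζ := ζ) (sel := sel) hℓ ⟨_, hQ⟩ ⟨_, hmem S hS⟩
    simp only [heta] at h
    simpa only [integral_Ploc_noiseLaw hp hq hpq σ b v S (hmeasX _ _)] using h
  have hcard : (0 : ℝ) < (powersetCard s (univ : Finset (Fin d))).card := by
    rw [Finset.card_powersetCard, Finset.card_univ, Fintype.card_fin]
    exact_mod_cast Nat.choose_pos hsd
  have hint2 : ∀ S ∈ powersetCard s (univ : Finset (Fin d)), Integrable (fun z =>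
      ∑ ω : Fin d → Fin 3, configWeight p q ω * ℓ (sel (obs b σ v S ω) z) (chi S)) ζ :=
    fun S _ => integrable_finsetSum _ fun ω _ => (hint _ _).const_mul _
  have h1 : ((powersetCard s (univ : Finset (Fin d))).card : ℝ) * C
      ≤ ∫ z, ∑ S ∈ powersetCard s (univ : Finset (Fin d)), ∑ ω : Fin d → Fin 3,
          configWeight p q ω * ℓ (sel (obs b σ v S ω) z) (chi S) ∂ζ := by
    calc ((powersetCard s (univ : Finset (Fin d))).card : ℝ) * C
        = ∫ _, ((powersetCard s (univ : Finset (Fin d))).card : ℝ) * C ∂ζ := by simp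
      _ ≤ _ := integral_mono (integrable_const _) (integrable_finsetSum _ hint2)
        fun z => hC fun X => sel X z
  rw [integral_finsetSum _ hint2] at h1
  have h2 := Finset.sum_le_card_nsmul _ _ _ hS
  rw [nsmul_eq_mul] at h2
  exact le_of_mul_le_mul_left (h1.trans h2) hcard

end

/-- The `0`-`1` loss. -/
def wrongLoss {d : ℕ} (x y : Fin d → Bool) : ℝ := if x ≠ y then 1 else 0

theorem abs_wrongLoss_le {d : ℕ} (x y : Fin d → Bool) : |wrongLoss x y| ≤ 1 := by
  unfold wrongLoss; split_ifs <;> norm_num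

theorem abs_hamming_le {d : ℕ} (x y : Fin d → Bool) : |(hamming x y : ℝ)| ≤ d := by
  rw [abs_of_nonneg (Nat.cast_nonneg _)]
  exact_mod_cast (Finset.card_filter_le _ _).trans_eq (by simp)

theorem wrongLoss_le_hamming {d : ℕ} (x y : Fin d → Bool) : wrongLoss x y ≤ hamming x y := by
  unfold wrongLoss
  split_ifs with h
  · obtain ⟨j, hj⟩ := Function.ne_iff.1 h
    have : 0 < hamming x y := Finset.card_pos.2 ⟨j, by simpa using hj⟩
    exact_mod_cast this
  · positivity

theorem wrongRisk_eq {ν σ : ℝ} {d s : ℕ} {a : ℝ} {Z : Type} [MeasurableSpace Z] (ζ : Measure Z)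
    {sel : (Fin d → ℝ) → Z → Fin d → Bool} (hsel : Measurable (Function.uncurry sel)) :
    (⨆ Q : Pclass ν, ⨆ μ : ThetaLoc d s a,
        ∫ z, ((Ploc σ Q.1 μ.1) {X | sel X z ≠ etaOf μ.1}).toReal ∂ζ)
      = maxRisk ν σ d s a ζ sel wrongLoss := by
  unfold maxRisk
  refine iSup_congr fun Q => iSup_congr fun μ => integral_congr_ae (ae_of_all _ fun z => ?_)
  have hmeas : MeasurableSet {X | sel X z ≠ etaOf μ.1} := by
    have h : Measurable fun X => sel X z := hsel.comp (measurable_id.prodMk measurable_const)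
    exact (h (measurableSet_singleton _)).compl
  simp only
  rw [← Measure.real, ← integral_indicator_one hmeas]
  refine integral_congr_ae (ae_of_all _ fun X => ?_)
  simp [wrongLoss, Set.indicator_apply]

theorem maxRisk_mono {ν σ : ℝ} {d s : ℕ} {a : ℝ} {Z : Type} [MeasurableSpace Z] {ζ : Measure Z}
    [IsProbabilityMeasure ζ] {sel : (Fin d → ℝ) → Z → Fin d → Bool}
    (hsel : Measurable (Function.uncurry sel)) :
    maxRisk ν σ d s a ζ sel wrongLoss
      ≤ maxRisk ν σ d s a ζ sel (fun x y => (hamming x y : ℝ)) := by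
  refine ciSup_mono (bddAbove_iSup_risk abs_hamming_le) fun Q =>
    ciSup_mono (bddAbove_risk abs_hamming_le Q) fun μ => ?_
  have := isProbabilityMeasure_Ploc σ Q μ.1
  have hjoint : ∀ (ℓ : (Fin d → Bool) → (Fin d → Bool) → ℝ) (M : ℝ), (∀ x y, |ℓ x y| ≤ M) →
      Integrable (fun z => ∫ X, ℓ (sel X z) (etaOf μ.1) ∂(Ploc σ Q.1 μ.1)) ζ := by
    intro ℓ M hℓ
    refine Integrable.of_bound (StronglyMeasurable.aestronglyMeasurable ?_) M
      (ae_of_all _ fun z => abs_integral_le _ fun X => hℓ _ _)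
    have h : Measurable fun w : Z × (Fin d → ℝ) => ℓ (sel w.2 w.1) (etaOf μ.1) :=
      (measurable_of_finite fun x => ℓ x (etaOf μ.1)).comp (hsel.comp measurable_swap)
    exact h.stronglyMeasurable.integral_prod_right
  have hX : ∀ (ℓ : (Fin d → Bool) → (Fin d → Bool) → ℝ) (M : ℝ), (∀ x y, |ℓ x y| ≤ M) →
      ∀ z, Integrable (fun X => ℓ (sel X z) (etaOf μ.1)) (Ploc σ Q.1 μ.1) := by
    intro ℓ M hℓ z
    refine Integrable.of_bound (Measurable.aestronglyMeasurable ?_) M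
      (ae_of_all _ fun X => hℓ _ _)
    exact (measurable_of_finite fun x => ℓ x (etaOf μ.1)).comp
      (hsel.comp (measurable_id.prodMk measurable_const))
  exact integral_mono (hjoint _ 1 abs_wrongLoss_le) (hjoint _ d abs_hamming_le) fun z =>
    integral_mono (hX _ 1 abs_wrongLoss_le z) (hX _ d abs_hamming_le z) fun X =>
      wrongLoss_le_hamming _ _

theorem hamRiskSet_nonempty (ν σ : ℝ) (d s : ℕ) (a : ℝ) : (HamRiskSetLoc ν σ d s a).Nonempty :=
  ⟨_, Unit, inferInstance, Measure.dirac (), inferInstance, fun _ _ _ => true,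
    measurable_const, rfl⟩

theorem wrongRiskSet_nonempty (ν σ : ℝ) (d s : ℕ) (a : ℝ) :
    (WrongRiskSetLoc ν σ d s a).Nonempty :=
  ⟨_, Unit, inferInstance, Measure.dirac (), inferInstance, fun _ _ _ => true,
    measurable_const, rfl⟩

theorem sInf_wrong_le_sInf_ham (ν σ : ℝ) (d s : ℕ) (a : ℝ) :
    sInf (WrongRiskSetLoc ν σ d s a) ≤ sInf (HamRiskSetLoc ν σ d s a) := by
  refine le_csInf (hamRiskSet_nonempty ν σ d s a) ?_
  rintro r ⟨Z, _, ζ, _, sel, hsel, rfl⟩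
  refine csInf_le_of_le ?_ ⟨Z, _, ζ, ‹_›, sel, hsel, rfl⟩ ?_
  · refine ⟨0, ?_⟩
    rintro r ⟨Z, _, ζ, _, sel, hsel, rfl⟩
    exact Real.iSup_nonneg fun Q => Real.iSup_nonneg fun μ =>
      integral_nonneg fun z => ENNReal.toReal_nonneg
  · rw [wrongRisk_eq ζ hsel]
    exact maxRisk_mono hsel

/-- The largest deviation whose tail bound in `Pclass ν` equals `log B / B`. -/
def deviation (ν B : ℝ) : ℝ := (ν * Real.log B - ν * Real.log (Real.log B)) ^ (1 / ν)

theorem three_lt_log {B : ℝ} (hB : Real.exp 3 < B) : 3 < Real.log B :=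
  (Real.lt_log_iff_exp_lt ((Real.exp_pos 3).trans hB)).2 hB

theorem deviation_pos {ν B : ℝ} (hν : 0 < ν) (hB : Real.exp 3 < B) : 0 < deviation ν B := by
  have h := three_lt_log hB
  have h2 := Real.log_le_sub_one_of_pos (show 0 < Real.log B by linarith)
  refine Real.rpow_pos_of_pos ?_ _
  rw [← mul_sub]
  exact mul_pos hν (by linarith)

theorem three_div_le_exp_deviation {ν B : ℝ} (hν : 0 < ν) (hB : Real.exp 3 < B) :
    3 / B ≤ Real.exp (-(deviation ν B ^ ν) / ν) := by
  have hB0 : 0 < B := (Real.exp_pos 3).trans hB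
  have h := three_lt_log hB
  have h2 := Real.log_le_sub_one_of_pos (show 0 < Real.log B by linarith)
  have h3 : 0 ≤ ν * Real.log B - ν * Real.log (Real.log B) := by
    rw [← mul_sub]
    exact (mul_pos hν (by linarith)).le
  rw [deviation, ← Real.rpow_mul h3, one_div_mul_cancel hν.ne', Real.rpow_one]
  have h4 : -(ν * Real.log B - ν * Real.log (Real.log B)) / ν
      = Real.log (Real.log B) - Real.log B := by
    field_simp; ring
  rw [h4, Real.exp_sub, Real.exp_log hB0, Real.exp_log (by linarith)]
  gcongr

theorem six_lt_exp_three : 6 < Real.exp 3 := by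
  have h := Real.exp_one_gt_d9
  have h2 : Real.exp 3 = Real.exp 1 ^ 3 := by rw [← Real.exp_nat_mul]; norm_num
  rw [h2]
  calc (6 : ℝ) < 2 ^ 3 := by norm_num
    _ ≤ Real.exp 1 ^ 3 := by gcongr; linarith

theorem wrong_lower_bound {ν σ a : ℝ} {d s : ℕ} (hν : 0 < ν) (hsd : s < d)
    (hσ : 0 < σ) (hm : Real.exp 3 < min ((d : ℝ) - s) (s : ℝ))
    (ha : a < σ * (deviation ν ((d : ℝ) - s) + deviation ν s)) :
    (1 - Real.exp (-1)) ^ 2 ≤ sInf (WrongRiskSetLoc ν σ d s a) := by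
  obtain ⟨h1, h2⟩ := lt_min_iff.1 hm
  have h6 := six_lt_exp_three
  have hd1 := deviation_pos hν h1
  have hd2 := deviation_pos hν h2
  have hp : 0 ≤ 3 / ((d : ℝ) - s) := div_nonneg (by norm_num) (by linarith)
  have hq : 0 ≤ 3 / (s : ℝ) := by positivity
  have hp2 : 3 / ((d : ℝ) - s) ≤ 1 / 2 := by
    rw [div_le_div_iff₀ (by linarith) (by norm_num)]; linarith
  have hq2 : 3 / (s : ℝ) ≤ 1 / 2 := by
    rw [div_le_div_iff₀ (by linarith) (by norm_num)]; linarith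
  refine le_csInf (wrongRiskSet_nonempty ν σ d s a) ?_
  rintro r ⟨Z, _, ζ, _, sel, hsel, rfl⟩
  rw [wrongRisk_eq ζ hsel]
  have hb : 0 < σ * (deviation ν ((d : ℝ) - s) + deviation ν s) := by positivity
  have hQ := noiseLaw_mem_Pclass hν hp hq (by linarith) hd1.le hd2.le
    (three_div_le_exp_deviation hν h1) (three_div_le_exp_deviation hν h2)
  refine le_trans ?_ (le_maxRisk_of_average abs_wrongLoss_le hsel hsd.le hb ha.le hp hq
    (by linarith) hQ fun D => wrong_average ?_ hp hq (by linarith) D)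
  · have hcast : (d : ℝ) - s = ((d - s : ℕ) : ℝ) := by rw [Nat.cast_sub hsd.le]
    have e1 : (1 - 3 / ((d : ℝ) - s)) ^ (d - s) ≤ Real.exp (-3) := by
      rw [hcast]
      exact Real.one_sub_div_pow_le_exp_neg (by rw [← hcast]; linarith)
    have e2 : (1 - 3 / (s : ℝ)) ^ s ≤ Real.exp (-3) :=
      Real.one_sub_div_pow_le_exp_neg (by linarith)
    have e3 : Real.exp (-3) = Real.exp (-1) ^ 3 := by rw [← Real.exp_nat_mul]; norm_num
    have e4 := Real.exp_neg_one_gt_d9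
    have e5 := Real.exp_neg_one_lt_d9
    have e6 : Real.exp (-1) ^ 3 ≤ (0.37 : ℝ) ^ 3 := by gcongr; linarith
    nlinarith
  · simp only [Matrix.cons_val_one, Matrix.cons_val]
    ring

theorem hamming_lower_bound {ν σ a A : ℝ} {d s : ℕ} (hν : 0 < ν) (hs : 1 ≤ s) (hsd : s < d)
    (hσ : 0 < σ) (hm : Real.exp 3 < min ((d : ℝ) / s - 1) A)
    (ha : a < σ * (deviation ν ((d : ℝ) / s - 1) + deviation ν A)) :
    (s : ℝ) / A ≤ sInf (HamRiskSetLoc ν σ d s a) := by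
  obtain ⟨h1, h2⟩ := lt_min_iff.1 hm
  have h6 := six_lt_exp_three
  have hd1 := deviation_pos hν h1
  have hd2 := deviation_pos hν h2
  have hs0 : (0 : ℝ) < s := by exact_mod_cast hs
  have hA0 : 0 < A := by linarith
  have hB0 : 0 < (d : ℝ) / s - 1 := by linarith
  have hp : 0 ≤ 2 / ((d : ℝ) / s - 1) := by positivity
  have hq : 0 ≤ 2 / A := by positivity
  have hp2 : 2 / ((d : ℝ) / s - 1) ≤ 1 / 2 := by
    rw [div_le_div_iff₀ hB0 (by norm_num)]; linarith
  have hq2 : 2 / A ≤ 1 / 2 := by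
    rw [div_le_div_iff₀ hA0 (by norm_num)]; linarith
  have hp3 : 2 / ((d : ℝ) / s - 1) ≤ 3 / ((d : ℝ) / s - 1) := by gcongr; norm_num
  have hq3 : 2 / A ≤ 3 / A := by gcongr; norm_num
  refine le_csInf (hamRiskSet_nonempty ν σ d s a) ?_
  rintro r ⟨Z, _, ζ, _, sel, hsel, rfl⟩
  have hb : 0 < σ * (deviation ν ((d : ℝ) / s - 1) + deviation ν A) := by positivity
  have hQ := noiseLaw_mem_Pclass hν hp hq (by linarith) hd1.le hd2.le
    (hp3.trans (three_div_le_exp_deviation hν h1)) (hq3.trans (three_div_le_exp_deviation hν h2))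
  refine le_trans (le_of_eq ?_) (le_maxRisk_of_average
    (ℓ := fun x y => (hamming x y : ℝ)) abs_hamming_le hsel hsd.le hb ha.le hp hq
    (by linarith) hQ fun D => hamming_average hs ?_ hp hq (by linarith) ?_ D)
  · ring
  · simp only [Matrix.cons_val_one, Matrix.cons_val]
    ring
  · have : (d : ℝ) - s = s * ((d : ℝ) / s - 1) := by field_simp
    rw [this, mul_assoc, mul_div_cancel₀ _ hB0.ne', mul_comm]

/-- Theorem 10 of the paper: non-asymptotic minimax lower bounds for
variable selection in the light-tail location model with noise class `𝒫_ν`, `ν > 1`. -/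
theorem statement16 (ν : ℝ) (hν : 1 < ν) :
    ∃ c c' : ℝ, 0 < c ∧ 0 < c' ∧
      sInf {t : ℝ | Real.exp 1 ≤ t ∧ c * Real.log (Real.log t) < ν * Real.log t} ≤ c' ∧
      (∀ (d s : ℕ) (σ a : ℝ), 2 < d → 1 ≤ s → s < d → 0 < σ → 0 < a →
        c' < min ((d : ℝ) - s) (s : ℝ) →
        a < σ * ((ν * Real.log ((d : ℝ) - s)
                  - c * Real.log (Real.log ((d : ℝ) - s))) ^ (1 / ν)
              + (ν * Real.log (s : ℝ) - c * Real.log (Real.log (s : ℝ))) ^ (1 / ν)) →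
        sInf (WrongRiskSetLoc ν σ d s a) ≤ sInf (HamRiskSetLoc ν σ d s a)
        ∧ (1 - Real.exp (-1)) ^ 2 ≤ sInf (WrongRiskSetLoc ν σ d s a)) ∧
      (∀ (d s : ℕ) (σ a A : ℝ), 2 < d → 1 ≤ s → s < d → 0 < σ → 0 < a → 1 < A →
        c' < min ((d : ℝ) / s - 1) A →
        a < σ * ((ν * Real.log ((d : ℝ) / s - 1)
                  - c * Real.log (Real.log ((d : ℝ) / s - 1))) ^ (1 / ν)
              + (ν * Real.log A - c * Real.log (Real.log A)) ^ (1 / ν)) →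
        (1 - Real.exp (-1)) / A ≤ (s : ℝ)⁻¹ * sInf (HamRiskSetLoc ν σ d s a)) := by
  have hν0 : 0 < ν := by linarith
  refine ⟨ν, Real.exp 3, hν0, Real.exp_pos 3, ?_, ?_, ?_⟩
  · have hmem : Real.exp 1 ∈
        {t : ℝ | Real.exp 1 ≤ t ∧ ν * Real.log (Real.log t) < ν * Real.log t} :=
      ⟨le_rfl, by simpa using hν0⟩
    exact (csInf_le ⟨Real.exp 1, fun t ht => ht.1⟩ hmem).trans
      (Real.exp_le_exp.2 (by norm_num))
  · intro d s σ a _ _ hsd hσ _ hm ha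
    exact ⟨sInf_wrong_le_sInf_ham ν σ d s a, wrong_lower_bound hν0 hsd hσ hm ha⟩
  · intro d s σ a A _ hs hsd hσ _ hA hm ha
    have h := hamming_lower_bound hν0 hs hsd hσ hm ha
    have hs0 : (0 : ℝ) < s := by exact_mod_cast hs
    have hA0 : 0 < A := by linarith
    calc (1 - Real.exp (-1)) / A ≤ 1 / A := by
          gcongr
          linarith [Real.exp_pos (-1)]
      _ = (s : ℝ)⁻¹ * (s / A) := by field_simp
      _ ≤ _ := by gcongr

end
end

section
/- There exist positive absolute constants c₁ and c₂ such that the following holds in the Gaussian group model. (i) If d − s ≥ c₂ and a² < c₁ σ²( log(d−s) ∨ √(k log(d−s)) ), then inf over all selectors η̃ of sup_{θ ∈ Θ_{k,d}(s,a)} E_θ|η̃ − η(θ)| ≥ inf over all selectors η̃ of sup_{θ ∈ Θ_{k,d}(s,a)} P_θ(S_{η̃} ≠ S_{η(θ)}) ≥ (1 − e^{−1})². (ii) If d/s ≥ c₂ and a² < c₁ σ²( log((d−s)/s) ∨ √(k log((d−s)/s)) ), then inf over all selectors η̃ of sup_{θ ∈ Θ_{k,d}(s,a)} (1/s) E_θ|η̃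 − η(θ)| ≥ (1 − e^{−1})/2. -/
open MeasureTheory Finset Filter
open scoped ENNReal Classical

noncomputable section

/-- Euclidean norm of a column vector in `ℝ^k`. -/
def normCol {k : ℕ} (v : Fin k → ℝ) : ℝ := Real.sqrt (∑ i, v i ^ 2)

/-- The class `Θ_{k,d}(s,a)` of `k × d` matrices (given by their columns) having exactly `s`
nonzero columns, each of Euclidean norm at least `a`. -/
def ThetaGrp (k d s : ℕ) (a : ℝ) : Set (Fin d → Fin k → ℝ) :=
  {θ | ∃ S : Finset (Fin d), S.card = s ∧ (∀ j ∈ S, a ≤ normCol (θ j)) ∧ ∀ j ∉ S, θ j = 0}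

/-- The binary vector `η(θ)` of nonzero columns of `θ`. -/
def etaGrp {k d : ℕ} (θ : Fin d → Fin k → ℝ) : Fin d → Bool := fun j => decide (θ j ≠ 0)

/-- The law `P_θ` of the observations `Y_{ij} = θ_{ij} + σ ξ_{ij}` with i.i.d. standard normal
noise `ξ_{ij}` (all entries independent, entry `(i,j)` Gaussian with mean `θ_{ij}` and
variance `σ²`). -/
def Pgrp (σ : ℝ) {k d : ℕ} (θ : Fin d → Fin k → ℝ) : Measure (Fin d → Fin k → ℝ) :=
  Measure.pi fun j => Measure.pi fun i =>
    ProbabilityTheory.gaussianReal (θ j i) ⟨σ ^ 2, sq_nonneg σ⟩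

/-- Expected Hamming risk of a nonrandomized column selector in the group model. -/
def detRiskGrp (σ : ℝ) {k d : ℕ}
    (sel : (Fin d → Fin k → ℝ) → Fin d → Bool) (θ : Fin d → Fin k → ℝ) : ℝ :=
  ∫ Y, (hamming (sel Y) (etaGrp θ) : ℝ) ∂(Pgrp σ θ)

/-- The set of maximal (over `θ ∈ Θ_{k,d}(s,a)`) expected Hamming risks of all (randomized,
measurable) column selectors. -/
def HamRiskSetGrp (σ : ℝ) (k d s : ℕ) (a : ℝ) : Set ℝ :=
  { r | ∃ (Z : Type) (_ : MeasurableSpace Z) (ζ : Measure Z),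
      IsProbabilityMeasure ζ ∧
      ∃ sel : (Fin d → Fin k → ℝ) → Z → Fin d → Bool,
        Measurable (Function.uncurry sel) ∧
        r = ⨆ θ : ThetaGrp k d s a,
              ∫ z, ∫ Y, (hamming (sel Y z) (etaGrp θ.1) : ℝ) ∂(Pgrp σ θ.1) ∂ζ }

/-- The set of maximal (over `θ ∈ Θ_{k,d}(s,a)`) probabilities of wrong recovery of all
(randomized, measurable) column selectors. -/
def WrongRiskSetGrp (σ : ℝ) (k d s : ℕ) (a : ℝ) : Set ℝ :=
  { r | ∃ (Z : Type) (_ : MeasurableSpace Z) (ζ : Measure Z),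
      IsProbabilityMeasure ζ ∧
      ∃ sel : (Fin d → Fin k → ℝ) → Z → Fin d → Bool,
        Measurable (Function.uncurry sel) ∧
        r = ⨆ θ : ThetaGrp k d s a,
              ∫ z, ((Pgrp σ θ.1) {Y | sel Y z ≠ etaGrp θ.1}).toReal ∂ζ }


open ProbabilityTheory

lemma lintegral_pi_prod {ι : Type*} [Fintype ι] {X : ι → Type*} [∀ i, MeasurableSpace (X i)]
    (μ : ∀ i, Measure (X i)) [∀ i, IsProbabilityMeasure (μ i)] (f : ∀ i, X i → ℝ≥0∞)
    (hf : ∀ i, Measurable (f i)) :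
    ∫⁻ x, ∏ i, f i (x i) ∂Measure.pi μ = ∏ i, ∫⁻ x, f i x ∂μ i := by
  have h := lintegral_prod_eq_prod_lintegral_of_indepFun (μ := Measure.pi μ) univ
    (fun i x => f i (x i)) (iIndepFun_pi (fun i => (hf i).aemeasurable))
    (fun i => (hf i).comp (measurable_pi_apply i))
  rw [h]
  refine Finset.prod_congr rfl fun i _ => ?_
  exact (measurePreserving_eval μ i).lintegral_comp (hf i)

lemma pi_eq_withDensity_prod {ι : Type*} [Fintype ι] {X : ι → Type*} [∀ i, MeasurableSpace (X i)]
    (μ ν : ∀ i, Measure (X i)) [∀ i, IsProbabilityMeasure (μ i)]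
    [∀ i, IsProbabilityMeasure (ν i)] (f : ∀ i, X i → ℝ≥0∞)
    (hf : ∀ i, Measurable (f i)) (h : ∀ i, ν i = (μ i).withDensity (f i)) :
    Measure.pi ν = (Measure.pi μ).withDensity fun x => ∏ i, f i (x i) := by
  refine Measure.pi_eq fun s hs => ?_
  rw [withDensity_apply _ (MeasurableSet.univ_pi hs),
    ← lintegral_indicator (MeasurableSet.univ_pi hs)]
  have : (Set.univ.pi s).indicator (fun x : ∀ i, X i => ∏ i, f i (x i))
      = fun x => ∏ i, (s i).indicator (f i) (x i) := by
    ext x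
    by_cases hx : x ∈ Set.univ.pi s
    · rw [Set.indicator_of_mem hx]
      exact Finset.prod_congr rfl fun i _ =>
        (Set.indicator_of_mem (hx i (Set.mem_univ i)) _).symm
    · rw [Set.indicator_of_notMem hx]
      simp only [Set.mem_univ_pi, not_forall] at hx
      obtain ⟨i, hi⟩ := hx
      exact (Finset.prod_eq_zero (mem_univ i) (Set.indicator_of_notMem hi _)).symm
  rw [this, lintegral_pi_prod μ _ fun i => (hf i).indicator (hs i)]
  refine Finset.prod_congr rfl fun i _ => ?_
  rw [h i, withDensity_apply _ (hs i), lintegral_indicator (hs i)]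

lemma gaussianReal_add_eq_withDensity (m δ : ℝ) {v : NNReal} (hv : v ≠ 0) :
    gaussianReal (m + δ) v = (gaussianReal m v).withDensity
      fun x => ENNReal.ofReal (Real.exp (δ * (x - m) / v - δ ^ 2 / (2 * v))) := by
  have hv' : (v : ℝ) ≠ 0 := by exact_mod_cast hv
  rw [gaussianReal_of_var_ne_zero _ hv, gaussianReal_of_var_ne_zero _ hv,
    ← withDensity_mul _ (measurable_gaussianPDF _ _) (by fun_prop)]
  congr 1
  ext x
  simp only [Pi.mul_apply, gaussianPDF, gaussianPDFReal]
  rw [← ENNReal.ofReal_mul (by positivity), mul_assoc _ (Real.exp _), ← Real.exp_add]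
  congr 3
  field_simp
  ring

lemma Pgrp_eq (σ : ℝ) {k d : ℕ} (θ : Fin d → Fin k → ℝ) :
    Pgrp σ θ = Measure.pi fun j => Measure.pi fun i =>
      gaussianReal (θ j i) (Real.toNNReal (σ ^ 2)) := by
  have : (⟨σ ^ 2, sq_nonneg σ⟩ : NNReal) = Real.toNNReal (σ ^ 2) :=
    (Real.toNNReal_of_nonneg (sq_nonneg σ)).symm
  unfold Pgrp
  rw [this]

instance isProbabilityMeasure_Pgrp (σ : ℝ) {k d : ℕ} (θ : Fin d → Fin k → ℝ) :
    IsProbabilityMeasure (Pgrp σ θ) := by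
  rw [Pgrp_eq]; infer_instance

/-- Likelihood ratio of the shifted observations with respect to the unshifted ones. -/
def likelihoodRatio (σ : ℝ) {k d : ℕ} (θ δ Y : Fin d → Fin k → ℝ) : ℝ :=
  Real.exp (∑ j, ∑ i, (δ j i * (Y j i - θ j i) / σ ^ 2 - δ j i ^ 2 / (2 * σ ^ 2)))

lemma measurable_likelihoodRatio (σ : ℝ) {k d : ℕ} (θ δ : Fin d → Fin k → ℝ) :
    Measurable (likelihoodRatio σ θ δ) := by
  unfold likelihoodRatio; fun_prop

lemma likelihoodRatio_pos (σ : ℝ) {k d : ℕ} (θ δ Y : Fin d → Fin k → ℝ) :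
    0 < likelihoodRatio σ θ δ Y := Real.exp_pos _

lemma Pgrp_add_eq_withDensity {σ : ℝ} (hσ : 0 < σ) {k d : ℕ} (θ δ : Fin d → Fin k → ℝ) :
    Pgrp σ (θ + δ) =
      (Pgrp σ θ).withDensity fun Y => ENNReal.ofReal (likelihoodRatio σ θ δ Y) := by
  have hv : Real.toNNReal (σ ^ 2) ≠ 0 := by
    rw [Ne, Real.toNNReal_eq_zero, not_le]
    positivity
  have hc : ((Real.toNNReal (σ ^ 2) : NNReal) : ℝ) = σ ^ 2 := Real.coe_toNNReal _ (sq_nonneg σ)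
  rw [Pgrp_eq, Pgrp_eq]
  rw [pi_eq_withDensity_prod (fun j => Measure.pi fun i =>
      gaussianReal (θ j i) (Real.toNNReal (σ ^ 2)))
    (fun j => Measure.pi fun i => gaussianReal ((θ + δ) j i) (Real.toNNReal (σ ^ 2)))
    (fun j y => ∏ i, ENNReal.ofReal
      (Real.exp (δ j i * (y i - θ j i) / σ ^ 2 - δ j i ^ 2 / (2 * σ ^ 2)))) (by fun_prop)
    (fun j => pi_eq_withDensity_prod (fun i => gaussianReal (θ j i) (Real.toNNReal (σ ^ 2)))
      (fun i => gaussianReal ((θ + δ) j i) (Real.toNNReal (σ ^ 2)))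
      (fun i y => ENNReal.ofReal
        (Real.exp (δ j i * (y - θ j i) / σ ^ 2 - δ j i ^ 2 / (2 * σ ^ 2)))) (by fun_prop)
      fun i => by
        rw [Pi.add_apply, Pi.add_apply, gaussianReal_add_eq_withDensity _ _ hv, hc])]
  congr 1
  ext Y
  rw [likelihoodRatio, Real.exp_sum, ENNReal.ofReal_prod_of_nonneg (fun _ _ => (Real.exp_pos _).le)]
  refine Finset.prod_congr rfl fun j _ => ?_
  rw [Real.exp_sum, ENNReal.ofReal_prod_of_nonneg (fun _ _ => (Real.exp_pos _).le)]

lemma lintegral_likelihoodRatio {σ : ℝ} (hσ : 0 < σ) {k d : ℕ} (θ δ : Fin d → Fin k → ℝ) :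
    ∫⁻ Y, ENNReal.ofReal (likelihoodRatio σ θ δ Y) ∂Pgrp σ θ = 1 := by
  rw [← setLIntegral_univ, ← withDensity_apply _ MeasurableSet.univ,
    ← Pgrp_add_eq_withDensity hσ, measure_univ]

lemma integrable_likelihoodRatio {σ : ℝ} (hσ : 0 < σ) {k d : ℕ} (θ δ : Fin d → Fin k → ℝ) :
    Integrable (likelihoodRatio σ θ δ) (Pgrp σ θ) := by
  refine ⟨(measurable_likelihoodRatio σ θ δ).aestronglyMeasurable, ?_⟩
  rw [hasFiniteIntegral_iff_ofReal (ae_of_all _ fun Y => (likelihoodRatio_pos σ θ δ Y).le),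
    lintegral_likelihoodRatio hσ]
  exact ENNReal.one_lt_top

lemma integral_likelihoodRatio {σ : ℝ} (hσ : 0 < σ) {k d : ℕ} (θ δ : Fin d → Fin k → ℝ) :
    ∫ Y, likelihoodRatio σ θ δ Y ∂Pgrp σ θ = 1 := by
  rw [integral_eq_lintegral_of_nonneg_ae (ae_of_all _ fun Y => (likelihoodRatio_pos σ θ δ Y).le)
    (measurable_likelihoodRatio σ θ δ).aestronglyMeasurable, lintegral_likelihoodRatio hσ]
  simp

lemma measureReal_Pgrp_add {σ : ℝ} (hσ : 0 < σ) {k d : ℕ} (θ δ : Fin d → Fin k → ℝ)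
    {A : Set (Fin d → Fin k → ℝ)} (hA : MeasurableSet A) :
    (Pgrp σ (θ + δ)).real A = ∫ Y in A, likelihoodRatio σ θ δ Y ∂Pgrp σ θ := by
  rw [measureReal_def, Pgrp_add_eq_withDensity hσ, withDensity_apply _ hA,
    integral_eq_lintegral_of_nonneg_ae (ae_of_all _ fun Y => (likelihoodRatio_pos σ θ δ Y).le)
    (measurable_likelihoodRatio σ θ δ).aestronglyMeasurable]

lemma likelihoodRatio_mul (σ : ℝ) {k d : ℕ} (θ δ δ' Y : Fin d → Fin k → ℝ) :
    likelihoodRatio σ θ δ Y * likelihoodRatio σ θ δ' Y =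
      Real.exp (∑ j, ∑ i, δ j i * δ' j i / σ ^ 2) * likelihoodRatio σ θ (δ + δ') Y := by
  simp only [likelihoodRatio, ← Real.exp_add, ← Finset.sum_add_distrib]
  congr 1
  refine Finset.sum_congr rfl fun j _ => Finset.sum_congr rfl fun i _ => ?_
  simp only [Pi.add_apply]
  ring

/-- The vector of `ℝ^k` with Euclidean norm `a`, entries of equal modulus and signs `ε`. -/
def signVec (a : ℝ) {k : ℕ} (ε : Fin k → Bool) : Fin k → ℝ :=
  fun i => a / √k * if ε i then 1 else -1

lemma normCol_signVec {a : ℝ} (ha : 0 < a) {k : ℕ} (hk : 1 ≤ k) (ε : Fin k → Bool) :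
    normCol (signVec a ε) = a := by
  have hk' : (0 : ℝ) < k := by exact_mod_cast hk
  have h : ∀ i, signVec a ε i ^ 2 = a ^ 2 / k := fun i => by
    unfold signVec
    split_ifs <;> simp [div_pow, Real.sq_sqrt hk'.le]
  rw [normCol, Finset.sum_congr rfl fun i _ => h i]
  simp only [sum_const, card_univ, Fintype.card_fin, nsmul_eq_mul]
  rw [mul_div_cancel₀ _ hk'.ne', Real.sqrt_sq ha.le]

lemma signVec_ne_zero {a : ℝ} (ha : 0 < a) {k : ℕ} (hk : 1 ≤ k) (ε : Fin k → Bool) :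
    signVec a ε ≠ 0 := by
  intro h
  have := normCol_signVec ha hk ε
  simp only [h, normCol, Pi.zero_apply] at this
  simp at this
  exact ha.ne this

lemma sum_sum_exp_signVec (σ a : ℝ) {k : ℕ} (hk : 1 ≤ k) :
    ∑ ε : Fin k → Bool, ∑ ε' : Fin k → Bool,
        Real.exp (∑ i, signVec a ε i * signVec a ε' i / σ ^ 2) =
      (2 ^ k) ^ 2 * Real.cosh (a ^ 2 / (k * σ ^ 2)) ^ k := by
  have hk' : (0 : ℝ) < k := by exact_mod_cast hk
  have key : ∀ ε : Fin k → Bool, ∑ ε' : Fin k → Bool,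
      Real.exp (∑ i, signVec a ε i * signVec a ε' i / σ ^ 2) =
      (2 * Real.cosh (a ^ 2 / (k * σ ^ 2))) ^ k := by
    intro ε
    have h := Finset.prod_univ_sum (fun _ : Fin k => (univ : Finset Bool))
      (fun i e => Real.exp (signVec a ε i * (a / √k * if e then 1 else -1) / σ ^ 2))
    rw [Fintype.piFinset_univ] at h
    simp only [Real.exp_sum]
    rw [show (∑ ε' : Fin k → Bool, ∏ i, Real.exp (signVec a ε i * signVec a ε' i / σ ^ 2)) =
      ∑ x : Fin k → Bool, ∏ i, Real.exp (signVec a ε i *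
        (a / √k * if x i = true then 1 else -1) / σ ^ 2) from rfl, ← h]
    have h2 : ∀ i, ∑ e : Bool, Real.exp (signVec a ε i * (a / √k * if e then 1 else -1) / σ ^ 2) =
        2 * Real.cosh (a ^ 2 / (k * σ ^ 2)) := by
      intro i
      have h3 : a / √k * (a / √k) = a ^ 2 / k := by
        rw [div_mul_div_comm, Real.mul_self_sqrt hk'.le, sq]
      rw [Real.cosh_eq, Fintype.sum_bool, ← div_div, ← h3]
      unfold signVec
      cases ε i <;> simp <;> ring_nf
    rw [Finset.prod_congr rfl fun i _ => h2 i]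
    simp
  rw [Finset.sum_congr rfl fun ε _ => key ε]
  simp [mul_pow]
  ring

lemma integrable_sq_sum_likelihoodRatio {σ : ℝ} (hσ : 0 < σ) {k d : ℕ} {ι : Type*} [Fintype ι]
    (θ : Fin d → Fin k → ℝ) (δ : ι → Fin d → Fin k → ℝ) :
    Integrable (fun Y => (∑ ε, likelihoodRatio σ θ (δ ε) Y) ^ 2) (Pgrp σ θ) := by
  simp only [sq, Finset.sum_mul_sum, likelihoodRatio_mul]
  exact integrable_finsetSum _ fun ε _ => integrable_finsetSum _ fun ε' _ =>
    (integrable_likelihoodRatio hσ _ _).const_mul _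

lemma integral_sq_sum_likelihoodRatio {σ : ℝ} (hσ : 0 < σ) {k d : ℕ} {ι : Type*} [Fintype ι]
    (θ : Fin d → Fin k → ℝ) (δ : ι → Fin d → Fin k → ℝ) :
    ∫ Y, (∑ ε, likelihoodRatio σ θ (δ ε) Y) ^ 2 ∂Pgrp σ θ =
      ∑ ε, ∑ ε', Real.exp (∑ j, ∑ i, δ ε j i * δ ε' j i / σ ^ 2) := by
  simp only [sq (∑ _, _), Finset.sum_mul_sum, likelihoodRatio_mul]
  rw [integral_finsetSum _ fun ε _ => integrable_finsetSum _ fun ε' _ =>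
    (integrable_likelihoodRatio hσ _ _).const_mul _]
  refine Finset.sum_congr rfl fun ε _ => ?_
  rw [integral_finsetSum _ fun ε' _ => (integrable_likelihoodRatio hσ _ _).const_mul _]
  refine Finset.sum_congr rfl fun ε' _ => ?_
  rw [integral_const_mul, integral_likelihoodRatio hσ, mul_one]

lemma integral_sq_sum_likelihoodRatio_single {σ : ℝ} (hσ : 0 < σ) (a : ℝ) {k d : ℕ} (hk : 1 ≤ k)
    (θ : Fin d → Fin k → ℝ) (j : Fin d) :
    ∫ Y, (∑ ε : Fin k → Bool, likelihoodRatio σ θ (Pi.single j (signVec a ε)) Y) ^ 2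
        ∂Pgrp σ θ = (2 ^ k) ^ 2 * Real.cosh (a ^ 2 / (k * σ ^ 2)) ^ k := by
  rw [integral_sq_sum_likelihoodRatio hσ, ← sum_sum_exp_signVec σ a hk]
  refine Finset.sum_congr rfl fun ε _ => Finset.sum_congr rfl fun ε' _ => ?_
  rw [Finset.sum_eq_single j (fun i _ hi => by simp [Pi.single_eq_of_ne hi]) (by simp)]
  simp

/-- Among `m` candidate positions with random signs, no family of disjoint decision regions
identifies the position of the shift with average probability more than one half. -/
lemma sum_measureReal_shift_le {σ : ℝ} (hσ : 0 < σ) (a : ℝ) {k d m : ℕ} (hk : 1 ≤ k) (hm : 1 ≤ m)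
    (hcosh : Real.cosh (a ^ 2 / (k * σ ^ 2)) ^ k ≤ m / 4)
    (θ : Fin d → Fin k → ℝ) (b : Fin m → Fin d) (A : Fin m → Set (Fin d → Fin k → ℝ))
    (hA : ∀ j, MeasurableSet (A j)) (hdisj : Pairwise (Function.onFun Disjoint A)) :
    ∑ j, ∑ ε : Fin k → Bool, (Pgrp σ (θ + Pi.single (b j) (signVec a ε))).real (A j) ≤
      m * 2 ^ k / 2 := by
  set P := Pgrp σ θ with hP
  have hm' : (0 : ℝ) < m := by exact_mod_cast hm
  set T : ℝ := m * 2 ^ k / 2 with hT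
  have hTpos : 0 < T := by positivity
  set L : Fin m → (Fin d → Fin k → ℝ) → ℝ :=
    fun j Y => ∑ ε : Fin k → Bool, likelihoodRatio σ θ (Pi.single (b j) (signVec a ε)) Y with hL
  have hLint : ∀ j, Integrable (L j) P := fun j =>
    integrable_finsetSum _ fun ε _ => integrable_likelihoodRatio hσ _ _
  have hLsq : ∀ j, Integrable (fun Y => L j Y ^ 2) P := fun j =>
    integrable_sq_sum_likelihoodRatio hσ _ _
  have h1 : ∀ j, ∑ ε : Fin k → Bool, (Pgrp σ (θ + Pi.single (b j) (signVec a ε))).real (A j) ≤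
      T / 2 * P.real (A j) + ((2 ^ k) ^ 2 * Real.cosh (a ^ 2 / (k * σ ^ 2)) ^ k) / (2 * T) := by
    intro j
    rw [Finset.sum_congr rfl fun ε _ => measureReal_Pgrp_add hσ _ _ (hA j),
      ← integral_finsetSum _ fun ε _ => (integrable_likelihoodRatio hσ _ _).integrableOn]
    calc ∫ Y in A j, L j Y ∂P
        ≤ ∫ Y in A j, (T / 2 + L j Y ^ 2 / (2 * T)) ∂P := by
          refine setIntegral_mono (hLint j).integrableOn
            ((integrable_const _).add ((hLsq j).div_const _)).integrableOn fun Y => ?_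
          have : T / 2 + L j Y ^ 2 / (2 * T) - L j Y = (T - L j Y) ^ 2 / (2 * T) := by
            field_simp
            ring
          have h2 : 0 ≤ (T - L j Y) ^ 2 / (2 * T) := by positivity
          show L j Y ≤ T / 2 + L j Y ^ 2 / (2 * T)
          linarith
      _ = T / 2 * P.real (A j) + (∫ Y in A j, L j Y ^ 2 ∂P) / (2 * T) := by
          rw [integral_add (integrable_const _) ((hLsq j).div_const _).integrableOn,
            integral_div (2 * T), setIntegral_const, smul_eq_mul, mul_comm]
      _ ≤ _ := by
          have h3 : ∫ Y in A j, L j Y ^ 2 ∂P ≤ ∫ Y, L j Y ^ 2 ∂P :=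
            setIntegral_le_integral (hLsq j) (ae_of_all _ fun Y => sq_nonneg _)
          rw [hL, integral_sq_sum_likelihoodRatio_single hσ a hk] at h3
          gcongr
  refine (Finset.sum_le_sum fun j _ => h1 j).trans ?_
  rw [Finset.sum_add_distrib, ← Finset.mul_sum]
  have h4 : ∑ j, P.real (A j) ≤ 1 := by
    rw [← measureReal_biUnion_finset (fun i _ j _ hij => hdisj hij) fun j _ => hA j]
    exact measureReal_le_one
  simp only [sum_const, card_univ, Fintype.card_fin, nsmul_eq_mul]
  have h5 : (m : ℝ) * ((2 ^ k) ^ 2 * Real.cosh (a ^ 2 / (k * σ ^ 2)) ^ k / (2 * T)) =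
      2 ^ k * Real.cosh (a ^ 2 / (k * σ ^ 2)) ^ k := by
    rw [hT]; field_simp
  rw [h5]
  have h6 : (2 : ℝ) ^ k * Real.cosh (a ^ 2 / (k * σ ^ 2)) ^ k ≤ 2 ^ k * (m / 4) := by gcongr
  have h7 : T / 2 * ∑ j, P.real (A j) ≤ T / 2 * 1 := by gcongr
  rw [hT] at h7 ⊢
  linarith

lemma le_sum_measureReal_compl_shift {σ : ℝ} (hσ : 0 < σ) (a : ℝ) {k d m : ℕ} (hk : 1 ≤ k)
    (hm : 1 ≤ m) (hcosh : Real.cosh (a ^ 2 / (k * σ ^ 2)) ^ k ≤ m / 4)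
    (θ : Fin d → Fin k → ℝ) (b : Fin m → Fin d) (A : Fin m → Set (Fin d → Fin k → ℝ))
    (hA : ∀ j, MeasurableSet (A j)) (hdisj : Pairwise (Function.onFun Disjoint A)) :
    m * 2 ^ k / 2 ≤ ∑ x : Fin m × (Fin k → Bool),
      (Pgrp σ (θ + Pi.single (b x.1) (signVec a x.2))).real (A x.1)ᶜ := by
  have h := sum_measureReal_shift_le hσ a hk hm hcosh θ b A hA hdisj
  have h1 : ∀ x : Fin m × (Fin k → Bool),
      (Pgrp σ (θ + Pi.single (b x.1) (signVec a x.2))).real (A x.1)ᶜ =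
      1 - (Pgrp σ (θ + Pi.single (b x.1) (signVec a x.2))).real (A x.1) := fun x =>
    probReal_compl_eq_one_sub (hA _)
  rw [Finset.sum_congr rfl fun x _ => h1 x, Finset.sum_sub_distrib, Fintype.sum_prod_type]
  rw [Fintype.sum_prod_type]
  simp only [sum_const, card_univ, Fintype.card_fin, nsmul_eq_mul, Fintype.card_pi,
    Fintype.card_bool, prod_const, mul_one]
  push_cast
  linarith

lemma cosh_pow_le_of_sq_lt {σ a n : ℝ} (hσ : 0 < σ) (ha : 0 < a) {k : ℕ} (hk : 1 ≤ k)
    (hn : 16 ≤ n)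
    (h : a ^ 2 < 1 / 2 * σ ^ 2 * max (Real.log n) √(k * Real.log n)) :
    Real.cosh (a ^ 2 / (k * σ ^ 2)) ^ k ≤ n / 4 := by
  have hk' : (0 : ℝ) < k := by exact_mod_cast hk
  have hn0 : 0 < n := by linarith
  have hlog : 0 < Real.log n := Real.log_pos (by linarith)
  have hfin : Real.exp (Real.log n / 2) ≤ n / 4 := by
    rw [Real.exp_half, Real.exp_log hn0]
    have := Real.sq_sqrt hn0.le
    have h4 : 4 ≤ √n := Real.le_sqrt_of_sq_le (by linarith)
    nlinarith
  refine le_trans ?_ hfin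
  set t := a ^ 2 / (k * σ ^ 2) with ht
  have ht0 : 0 < t := by positivity
  have hat : a ^ 2 = k * t * σ ^ 2 := by rw [ht]; field_simp
  rcases lt_max_iff.1 (show k * t * 2 < max (Real.log n) √(k * Real.log n) by
    rw [hat] at h
    have : 0 < σ ^ 2 := by positivity
    nlinarith) with h1 | h1
  · have : Real.cosh t ≤ Real.exp t := by
      rw [Real.cosh_eq]
      have : Real.exp (-t) ≤ Real.exp t := Real.exp_le_exp.2 (by linarith)
      linarith
    calc Real.cosh t ^ k ≤ Real.exp t ^ k := by gcongr
      _ = Real.exp (k * t) := by rw [← Real.exp_nat_mul]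
      _ ≤ _ := Real.exp_le_exp.2 (by linarith)
  · have h2 : (k * t * 2) ^ 2 < k * Real.log n := (Real.lt_sqrt (by positivity)).1 h1
    have h3 : 4 * k * t ^ 2 < Real.log n := by
      have : k * (4 * k * t ^ 2) < k * Real.log n := by linarith
      exact lt_of_mul_lt_mul_left this hk'.le
    calc Real.cosh t ^ k ≤ Real.exp (t ^ 2 / 2) ^ k := by
          gcongr
          exact Real.cosh_le_exp_half_sq t
      _ = Real.exp (k * (t ^ 2 / 2)) := by rw [← Real.exp_nat_mul]
      _ ≤ _ := Real.exp_le_exp.2 (by nlinarith [mul_pos hk' (sq_pos_of_pos ht0)])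

section Averaging

variable {Ω Z : Type*} [MeasurableSpace Ω] [MeasurableSpace Z] {d : ℕ}
  {sel : Ω → Z → Fin d → Bool}

lemma measurable_loss_comp (hsel : Measurable (Function.uncurry sel))
    (f : (Fin d → Bool) → ℝ) (z : Z) : Measurable fun Y => f (sel Y z) :=
  (Measurable.of_discrete (f := f)).comp (hsel.comp measurable_prodMk_right)

lemma integrable_loss_comp (hsel : Measurable (Function.uncurry sel))
    (P : Measure Ω) [IsProbabilityMeasure P] (f : (Fin d → Bool) → ℝ) (z : Z) :
    Integrable (fun Y => f (sel Y z)) P :=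
  Integrable.of_bound (measurable_loss_comp hsel f z).aestronglyMeasurable (∑ u, |f u|)
    (ae_of_all _ fun Y => Finset.single_le_sum (f := fun u => |f u|)
      (fun _ _ => abs_nonneg _) (mem_univ (sel Y z)))

lemma integrable_integral_loss_comp (hsel : Measurable (Function.uncurry sel))
    (P : Measure Ω) [IsProbabilityMeasure P] (ζ : Measure Z) [IsProbabilityMeasure ζ]
    (f : (Fin d → Bool) → ℝ) :
    Integrable (fun z => ∫ Y, f (sel Y z) ∂P) ζ := by
  have h : Integrable (fun x : Ω × Z => f (sel x.1 x.2)) (P.prod ζ) :=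
    Integrable.of_bound
      ((Measurable.of_discrete (f := f)).comp hsel).aestronglyMeasurable (∑ u, |f u|)
      (ae_of_all _ fun x => Finset.single_le_sum (f := fun u => |f u|)
        (fun _ _ => abs_nonneg _) (mem_univ (sel x.1 x.2)))
  exact h.integral_prod_right

lemma integral_integral_loss_comp_mono (hsel : Measurable (Function.uncurry sel))
    (P : Measure Ω) [IsProbabilityMeasure P] (ζ : Measure Z) [IsProbabilityMeasure ζ]
    {f g : (Fin d → Bool) → ℝ} (hfg : ∀ u, f u ≤ g u) :
    ∫ z, ∫ Y, f (sel Y z) ∂P ∂ζ ≤ ∫ z, ∫ Y, g (sel Y z) ∂P ∂ζ :=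
  integral_mono (integrable_integral_loss_comp hsel P ζ f)
    (integrable_integral_loss_comp hsel P ζ g) fun z =>
      integral_mono (integrable_loss_comp hsel P f z) (integrable_loss_comp hsel P g z)
        fun Y => hfg (sel Y z)

lemma integral_ite_ne_eq_toReal (hsel : Measurable (Function.uncurry sel))
    (P : Measure Ω) (u : Fin d → Bool) (z : Z) :
    ∫ Y, (if sel Y z ≠ u then (1 : ℝ) else 0) ∂P = (P {Y | sel Y z ≠ u}).toReal := by
  have hm : MeasurableSet {Y | sel Y z ≠ u} :=
    (hsel.comp measurable_prodMk_right) (MeasurableSet.of_discrete (s := {u}ᶜ))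
  rw [← measureReal_def, ← integral_indicator_one hm]
  refine integral_congr_ae (ae_of_all _ fun Y => ?_)
  simp [Set.indicator_apply]

lemma le_of_forall_card_mul_le_sum {X : Type*} [Fintype X] [Nonempty X]
    (ζ : Measure Z) [IsProbabilityMeasure ζ] {g : X → Z → ℝ} {c r : ℝ}
    (hg : ∀ x, Integrable (g x) ζ) (hr : ∀ x, ∫ z, g x z ∂ζ ≤ r)
    (hc : ∀ z, Fintype.card X * c ≤ ∑ x, g x z) : c ≤ r := by
  have h1 : Fintype.card X * c ≤ ∫ z, ∑ x, g x z ∂ζ := by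
    have := integral_mono (μ := ζ) (integrable_const (Fintype.card X * c))
      (integrable_finsetSum univ fun x _ => hg x) hc
    simpa using this
  rw [integral_finsetSum _ fun x _ => hg x] at h1
  have h2 : ∑ x, ∫ z, g x z ∂ζ ≤ Fintype.card X * r := by
    refine (Finset.sum_le_sum fun x _ => hr x).trans ?_
    simp
  have h3 : (0 : ℝ) < Fintype.card X := by exact_mod_cast Fintype.card_pos
  exact le_of_mul_le_mul_left (h1.trans h2) h3

end Averaging

lemma sum_sum_update {ι X : Type*} [Fintype ι] [DecidableEq ι] [Fintype X] (f : (ι → X) → ℝ)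
    (l : ι) : ∑ c : ι → X, ∑ x : X, f (Function.update c l x) =
      Fintype.card X * ∑ c, f c := by
  have hinv : Function.Involutive
      fun p : (ι → X) × X => (Function.update p.1 l p.2, p.1 l) := fun p => by simp
  have h := Equiv.sum_comp hinv.toPerm fun p : (ι → X) × X => f p.1
  simp only [Function.Involutive.coe_toPerm, Fintype.sum_prod_type] at h
  rw [h]
  simp [Finset.mul_sum]

lemma hamming_le {d : ℕ} (u v : Fin d → Bool) : hamming u v ≤ d := by
  unfold hamming
  exact (card_le_univ _).trans (by simp)

lemma ite_ne_le_hamming {d : ℕ} (u v : Fin d → Bool) :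
    (if u ≠ v then (1 : ℝ) else 0) ≤ hamming u v := by
  split_ifs with h
  · obtain ⟨j, hj⟩ := Function.ne_iff.1 h
    have : 0 < hamming u v := Finset.card_pos.2 ⟨j, by simpa using hj⟩
    exact_mod_cast this
  · positivity

lemma card_filter_block_ne_le_hamming {d s m : ℕ} (b : Fin s × Fin m ↪ Fin d)
    (u v : Fin d → Bool) :
    (univ.filter fun l => ∃ i, u (b (l, i)) ≠ v (b (l, i))).card ≤ hamming u v := by
  have h : ∀ l : {l // ∃ i, u (b (l, i)) ≠ v (b (l, i))},
      ∃ i, u (b (l, i)) ≠ v (b (l, i)) := fun l => l.2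
  choose i hi using h
  rw [← Fintype.card_subtype]
  refine Finset.card_le_card_of_injOn (s := univ) (fun l => b (l, i l)) (fun l _ => ?_)
    fun l _ l' _ h => ?_
  · simpa using hi l
  · exact Subtype.ext (congrArg Prod.fst (b.injective h))

section Risk

variable {σ a : ℝ} {k d s : ℕ} {Z : Type} [MeasurableSpace Z]
  {sel : (Fin d → Fin k → ℝ) → Z → Fin d → Bool}

lemma bddAbove_wrongRisk (ζ : Measure Z) [IsProbabilityMeasure ζ]
    (hsel : Measurable (Function.uncurry sel)) :
    BddAbove (Set.range fun θ : ThetaGrp k d s a =>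
      ∫ z, ((Pgrp σ θ.1) {Y | sel Y z ≠ etaGrp θ.1}).toReal ∂ζ) := by
  refine ⟨1, ?_⟩
  rintro _ ⟨θ, rfl⟩
  simp only [← integral_ite_ne_eq_toReal hsel]
  refine (integral_integral_loss_comp_mono hsel (Pgrp σ θ.1) ζ
    (f := fun u => if u ≠ etaGrp θ.1 then 1 else 0) (g := fun _ => 1)
    fun u => ?_).trans (by simp)
  split_ifs <;> norm_num

lemma bddAbove_hamRisk (ζ : Measure Z) [IsProbabilityMeasure ζ]
    (hsel : Measurable (Function.uncurry sel)) :
    BddAbove (Set.range fun θ : ThetaGrp k d s a =>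
      ∫ z, ∫ Y, (hamming (sel Y z) (etaGrp θ.1) : ℝ) ∂(Pgrp σ θ.1) ∂ζ) := by
  refine ⟨d, ?_⟩
  rintro _ ⟨θ, rfl⟩
  refine (integral_integral_loss_comp_mono hsel (Pgrp σ θ.1) ζ
    (f := fun u => hamming u (etaGrp θ.1)) (g := fun _ => d)
    fun u => ?_).trans (by simp)
  exact_mod_cast hamming_le _ _

lemma wrongRisk_le_hamRisk (ζ : Measure Z) [IsProbabilityMeasure ζ]
    (hsel : Measurable (Function.uncurry sel)) :
    ⨆ θ : ThetaGrp k d s a, ∫ z, ((Pgrp σ θ.1) {Y | sel Y z ≠ etaGrp θ.1}).toReal ∂ζ ≤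
      ⨆ θ : ThetaGrp k d s a,
        ∫ z, ∫ Y, (hamming (sel Y z) (etaGrp θ.1) : ℝ) ∂(Pgrp σ θ.1) ∂ζ := by
  refine ciSup_mono (bddAbove_hamRisk ζ hsel) fun θ => ?_
  simp only [← integral_ite_ne_eq_toReal hsel]
  exact integral_integral_loss_comp_mono hsel (Pgrp σ θ.1) ζ
    (f := fun u => if u ≠ etaGrp θ.1 then 1 else 0) (g := fun u => hamming u (etaGrp θ.1))
    fun u => ite_ne_le_hamming u _

end Risk

lemma wrongRiskSetGrp_nonempty (σ : ℝ) (k d s : ℕ) (a : ℝ) :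
    (WrongRiskSetGrp σ k d s a).Nonempty :=
  ⟨_, Unit, inferInstance, Measure.dirac (), inferInstance, fun _ _ _ => false,
    measurable_const, rfl⟩

lemma hamRiskSetGrp_nonempty (σ : ℝ) (k d s : ℕ) (a : ℝ) :
    (HamRiskSetGrp σ k d s a).Nonempty :=
  ⟨_, Unit, inferInstance, Measure.dirac (), inferInstance, fun _ _ _ => false,
    measurable_const, rfl⟩

lemma bddBelow_wrongRiskSetGrp (σ : ℝ) (k d s : ℕ) (a : ℝ) :
    BddBelow (WrongRiskSetGrp σ k d s a) := by
  refine ⟨0, ?_⟩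
  rintro _ ⟨Z, _, ζ, _, sel, _, rfl⟩
  exact Real.iSup_nonneg fun θ => integral_nonneg fun z => ENNReal.toReal_nonneg

lemma sInf_wrongRiskSetGrp_le (σ : ℝ) (k d s : ℕ) (a : ℝ) :
    sInf (WrongRiskSetGrp σ k d s a) ≤ sInf (HamRiskSetGrp σ k d s a) := by
  refine le_csInf (hamRiskSetGrp_nonempty σ k d s a) ?_
  rintro _ ⟨Z, _, ζ, _, sel, hsel, rfl⟩
  exact (csInf_le (bddBelow_wrongRiskSetGrp σ k d s a)
    ⟨Z, _, ζ, inferInstance, sel, hsel, rfl⟩).trans (wrongRisk_le_hamRisk ζ hsel)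

lemma half_le_sInf_wrongRiskSetGrp {σ a : ℝ} (hσ : 0 < σ) (ha : 0 < a) {k d s m : ℕ}
    (hk : 1 ≤ k) (hs : 1 ≤ s) (hm : 1 ≤ m) (hmd : s - 1 + m = d)
    (hcosh : Real.cosh (a ^ 2 / (k * σ ^ 2)) ^ k ≤ m / 4) :
    1 / 2 ≤ sInf (WrongRiskSetGrp σ k d s a) := by
  refine le_csInf (wrongRiskSetGrp_nonempty σ k d s a) ?_
  rintro _ ⟨Z, _, ζ, _, sel, hsel, rfl⟩
  subst hmd
  set b : Fin m → Fin (s - 1 + m) := Fin.natAdd (s - 1) with hb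
  have hbinj : Function.Injective b := Fin.natAdd_injective m (s - 1)
  have hblt : ∀ j, ¬ (b j : ℕ) < s - 1 := fun j => by simp [hb]
  set v := signVec a (k := k) fun _ => true with hv
  set θ₀ : Fin (s - 1 + m) → Fin k → ℝ := fun i => if (i : ℕ) < s - 1 then v else 0 with hθ₀
  set θ : Fin m × (Fin k → Bool) → Fin (s - 1 + m) → Fin k → ℝ :=
    fun x => θ₀ + Pi.single (b x.1) (signVec a x.2) with hθ
  have hval : ∀ x i, θ x i =
      if i = b x.1 then signVec a x.2 else if (i : ℕ) < s - 1 then v else 0 := by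
    intro x i
    simp only [hθ, hθ₀, Pi.add_apply]
    split_ifs with h1 h2 h2
    · exact absurd (h2 ▸ h1) (hblt _)
    · rw [Pi.single_eq_of_ne h2, add_zero]
    · subst h2; simp
    · rw [Pi.single_eq_of_ne h2, add_zero]
  set η : Fin m → Fin (s - 1 + m) → Bool :=
    fun j i => decide (i = b j ∨ (i : ℕ) < s - 1) with hη
  have heta : ∀ x, etaGrp (θ x) = η x.1 := by
    intro x
    ext i
    have h1 := signVec_ne_zero ha hk x.2
    have h2 : v ≠ 0 := signVec_ne_zero ha hk _
    simp only [etaGrp, hval, hη]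
    split_ifs <;> simp_all
  have hηinj : Function.Injective η := by
    intro j j' h
    have h1 := congrFun h (b j)
    simp only [hη, hblt, or_false, decide_true] at h1
    exact hbinj (of_decide_eq_true h1.symm)
  have hmem : ∀ x, θ x ∈ ThetaGrp k (s - 1 + m) s a := by
    intro x
    refine ⟨insert (b x.1) (univ.map (Fin.castAddEmb m)), ?_, ?_, ?_⟩
    · rw [card_insert_of_notMem, card_map, card_univ, Fintype.card_fin]
      · omega
      · simp only [Finset.mem_map, mem_univ, true_and, not_exists]
        intro i hi
        exact hblt x.1 (by rw [← hi]; simp)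
    · intro j _
      have : θ x j ≠ 0 → a ≤ normCol (θ x j) := by
        rw [hval]
        split_ifs
        · exact fun _ => (normCol_signVec ha hk _).ge
        · exact fun _ => (normCol_signVec ha hk _).ge
        · exact fun h => absurd rfl h
      refine this ?_
      have h1 := signVec_ne_zero ha hk x.2
      have h2 : v ≠ 0 := signVec_ne_zero ha hk _
      rw [hval]
      split_ifs with h3 h4
      · exact h1
      · exact h2
      · rename_i hj
        rcases mem_insert.1 hj with h | h
        · exact absurd h h3
        · obtain ⟨i, -, rfl⟩ := Finset.mem_map.1 h
          exact absurd (by simp) h4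
    · intro j hj
      rw [hval, if_neg fun h => hj (by rw [h]; exact mem_insert_self _ _), if_neg]
      intro h
      exact hj (mem_insert_of_mem (Finset.mem_map.2 ⟨⟨j, h⟩, mem_univ _, by ext; simp⟩))
  have : Nonempty (Fin m) := ⟨⟨0, hm⟩⟩
  refine le_of_forall_card_mul_le_sum (X := Fin m × (Fin k → Bool)) ζ
    (g := fun x z => ((Pgrp σ (θ x)) {Y | sel Y z ≠ etaGrp (θ x)}).toReal)
    (fun x => ?_) (fun x => ?_) fun z => ?_
  · simp only [← integral_ite_ne_eq_toReal hsel]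
    exact integrable_integral_loss_comp hsel _ ζ fun u => if u ≠ etaGrp (θ x) then 1 else 0
  · exact le_ciSup (bddAbove_wrongRisk ζ hsel) ⟨θ x, hmem x⟩
  · have h := le_sum_measureReal_compl_shift hσ a hk hm hcosh θ₀ b
      (fun j => {Y | sel Y z = η j})
      (fun j => (hsel.comp measurable_prodMk_right) (MeasurableSet.of_discrete (s := {η j})))
      (fun j j' hjj => Set.disjoint_left.2 fun Y h1 h2 => hjj (hηinj (h1.symm.trans h2)))
    have hcard : (Fintype.card (Fin m × (Fin k → Bool)) : ℝ) * (1 / 2) = m * 2 ^ k / 2 := by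
      simp
      ring
    rw [hcard]
    refine h.trans_eq (Finset.sum_congr rfl fun x _ => ?_)
    rw [heta]
    rfl

/-- The mean matrix with one shifted column in each block of `b`, at the position and with the
signs prescribed by `c`. -/
def blockMean (a : ℝ) {k d s m : ℕ} (b : Fin s × Fin m ↪ Fin d)
    (c : Fin s → Fin m × (Fin k → Bool)) : Fin d → Fin k → ℝ :=
  ∑ l, Pi.single (b (l, (c l).1)) (signVec a (c l).2)

section BlockMean

variable {a : ℝ} {k d s m : ℕ} (b : Fin s × Fin m ↪ Fin d) (c : Fin s → Fin m × (Fin k → Bool))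

lemma blockMean_apply (l : Fin s) (j : Fin m) :
    blockMean a b c (b (l, j)) = if j = (c l).1 then signVec a (c l).2 else 0 := by
  rw [blockMean, Finset.sum_apply, Finset.sum_eq_single l]
  · split_ifs with h
    · rw [h, Pi.single_eq_same]
    · rw [Pi.single_eq_of_ne]
      simpa using h
  · intro l' _ hl
    rw [Pi.single_eq_of_ne]
    simp [hl.symm]
  · simp

lemma etaGrp_blockMean (ha : 0 < a) (hk : 1 ≤ k) (l : Fin s) (j : Fin m) :
    etaGrp (blockMean a b c) (b (l, j)) = decide (j = (c l).1) := by
  have := signVec_ne_zero ha hk (c l).2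
  rw [etaGrp, blockMean_apply]
  split_ifs with h <;> simp [h, this]

lemma blockMean_mem_ThetaGrp (ha : 0 < a) (hk : 1 ≤ k) :
    blockMean a b c ∈ ThetaGrp k d s a := by
  refine ⟨univ.image fun l => b (l, (c l).1), ?_, ?_, ?_⟩
  · rw [card_image_of_injective _ fun l l' h => congrArg Prod.fst (b.injective h)]
    simp
  · intro j hj
    obtain ⟨l, -, rfl⟩ := mem_image.1 hj
    rw [blockMean_apply, if_pos rfl, normCol_signVec ha hk]
  · intro j hj
    rw [blockMean, Finset.sum_apply]
    refine Finset.sum_eq_zero fun l _ => Pi.single_eq_of_ne ?_ _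
    rintro rfl
    exact hj (mem_image.2 ⟨l, mem_univ _, rfl⟩)

lemma blockMean_update (l : Fin s) (x : Fin m × (Fin k → Bool)) :
    blockMean a b (Function.update c l x) =
      ∑ l' ∈ univ.erase l, Pi.single (b (l', (c l').1)) (signVec a (c l').2) +
        Pi.single (b (l, x.1)) (signVec a x.2) := by
  rw [blockMean, ← Finset.sum_erase_add _ _ (mem_univ l), Function.update_self]
  congr 1
  refine Finset.sum_congr rfl fun l' hl' => ?_
  rw [Function.update_of_ne (ne_of_mem_erase hl')]

end BlockMean

lemma half_mul_le_sInf_hamRiskSetGrp {σ a : ℝ} (hσ : 0 < σ) (ha : 0 < a) {k d s m : ℕ}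
    (hk : 1 ≤ k) (hm : 1 ≤ m) (hmd : s * m ≤ d)
    (hcosh : Real.cosh (a ^ 2 / (k * σ ^ 2)) ^ k ≤ m / 4) :
    (s : ℝ) / 2 ≤ sInf (HamRiskSetGrp σ k d s a) := by
  refine le_csInf (hamRiskSetGrp_nonempty σ k d s a) ?_
  rintro _ ⟨Z, _, ζ, _, sel, hsel, rfl⟩
  obtain ⟨b⟩ : Nonempty (Fin s × Fin m ↪ Fin d) :=
    Function.Embedding.nonempty_of_card_le (by simpa using hmd)
  have : Nonempty (Fin m) := ⟨⟨0, hm⟩⟩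
  refine le_of_forall_card_mul_le_sum (X := Fin s → Fin m × (Fin k → Bool)) ζ
    (g := fun c z => ∫ Y, (hamming (sel Y z) (etaGrp (blockMean a b c)) : ℝ)
      ∂Pgrp σ (blockMean a b c))
    (fun c => ?_) (fun c => ?_) fun z => ?_
  · exact integrable_integral_loss_comp hsel _ ζ
      fun u => (hamming u (etaGrp (blockMean a b c)) : ℝ)
  · exact le_ciSup (bddAbove_hamRisk ζ hsel) ⟨blockMean a b c, blockMean_mem_ThetaGrp b c ha hk⟩
  set A : Fin s → Fin m → Set (Fin d → Fin k → ℝ) :=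
    fun l j => {Y | ∀ i, sel Y z (b (l, i)) = decide (i = j)} with hA
  have hAm : ∀ l j, MeasurableSet (A l j) := fun l j =>
    (hsel.comp measurable_prodMk_right)
      (MeasurableSet.of_discrete (s := {u : Fin d → Bool | ∀ i, u (b (l, i)) = decide (i = j)}))
  have hdisj : ∀ l, Pairwise (Function.onFun Disjoint (A l)) := fun l j j' hjj =>
    Set.disjoint_left.2 fun Y h1 h2 => hjj (of_decide_eq_true (by rw [← h2 j, h1 j]; simp))
  have hham : ∀ c : Fin s → Fin m × (Fin k → Bool),
      ∑ l, (Pgrp σ (blockMean a b c)).real (A l (c l).1)ᶜ ≤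
      ∫ Y, (hamming (sel Y z) (etaGrp (blockMean a b c)) : ℝ) ∂Pgrp σ (blockMean a b c) := by
    intro c
    have h1 : ∀ l, (Pgrp σ (blockMean a b c)).real (A l (c l).1)ᶜ =
        ∫ Y, (A l (c l).1)ᶜ.indicator 1 Y ∂Pgrp σ (blockMean a b c) := fun l =>
      (integral_indicator_one (hAm _ _).compl).symm
    have hint : ∀ l, Integrable ((A l (c l).1)ᶜ.indicator (1 : (Fin d → Fin k → ℝ) → ℝ))
        (Pgrp σ (blockMean a b c)) := fun l =>
      (integrable_const (1 : ℝ)).indicator (hAm _ _).compl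
    rw [Finset.sum_congr rfl fun l _ => h1 l, ← integral_finsetSum _ fun l _ => hint l]
    refine integral_mono (integrable_finsetSum _ fun l _ => hint l)
      (integrable_loss_comp hsel _ (fun u => (hamming u (etaGrp (blockMean a b c)) : ℝ)) z)
      fun Y => ?_
    have h2 := card_filter_block_ne_le_hamming b (sel Y z) (etaGrp (blockMean a b c))
    refine le_trans (le_of_eq ?_) (Nat.cast_le.2 h2)
    rw [Finset.card_filter, Nat.cast_sum]
    refine Finset.sum_congr rfl fun l _ => ?_
    simp [Set.indicator_apply, hA, etaGrp_blockMean b c ha hk]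
  refine le_trans ?_ (Finset.sum_le_sum fun c _ => hham c)
  rw [Finset.sum_comm]
  set N : ℝ := (Fintype.card (Fin m × (Fin k → Bool)) : ℝ) with hN
  have hNpos : 0 < N := by
    rw [hN]
    exact_mod_cast Fintype.card_pos
  have hN' : (m : ℝ) * 2 ^ k / 2 = N / 2 := by simp [hN]
  set M : ℝ := (Fintype.card (Fin s → Fin m × (Fin k → Bool)) : ℝ) with hM
  have hblock : ∀ l, M / 2 ≤ ∑ c : Fin s → Fin m × (Fin k → Bool),
      (Pgrp σ (blockMean a b c)).real (A l (c l).1)ᶜ := by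
    intro l
    have h1 := sum_sum_update (fun c : Fin s → Fin m × (Fin k → Bool) =>
      (Pgrp σ (blockMean a b c)).real (A l (c l).1)ᶜ) l
    have h2 : M * (N / 2) ≤ N * ∑ c : Fin s → Fin m × (Fin k → Bool),
        (Pgrp σ (blockMean a b c)).real (A l (c l).1)ᶜ := by
      rw [← h1, hM, ← nsmul_eq_mul, ← Finset.card_univ, ← Finset.sum_const]
      refine Finset.sum_le_sum fun c _ => ?_
      have h3 := le_sum_measureReal_compl_shift hσ a hk hm hcosh
        (∑ l' ∈ univ.erase l, Pi.single (b (l', (c l').1)) (signVec a (c l').2))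
        (fun j => b (l, j)) (A l) (hAm l) (hdisj l)
      rw [hN'] at h3
      simpa only [blockMean_update, Function.update_self] using h3
    have h3 : N * (M / 2) ≤ N * ∑ c : Fin s → Fin m × (Fin k → Bool),
        (Pgrp σ (blockMean a b c)).real (A l (c l).1)ᶜ := by linarith
    exact le_of_mul_le_mul_left h3 hNpos
  refine le_trans (le_of_eq ?_) (Finset.sum_le_sum fun l _ => hblock l)
  simp
  ring

/-- Theorem 12 of the paper: minimax lower bounds for group variable
selection under Gaussian noise, implying the necessary conditions of exact and almost full
recovery. -/
theorem statement18 :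
    ∃ c₁ c₂ : ℝ, 0 < c₁ ∧ 0 < c₂ ∧
      (∀ (k d s : ℕ) (σ a : ℝ), 1 ≤ k → 2 < d → 1 ≤ s → s < d → 0 < σ → 0 < a →
        c₂ ≤ (d : ℝ) - s →
        a ^ 2 < c₁ * σ ^ 2 *
            max (Real.log ((d : ℝ) - s)) (Real.sqrt ((k : ℝ) * Real.log ((d : ℝ) - s))) →
        sInf (WrongRiskSetGrp σ k d s a) ≤ sInf (HamRiskSetGrp σ k d s a)
        ∧ (1 - Real.exp (-1)) ^ 2 ≤ sInf (WrongRiskSetGrp σ k d s a)) ∧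
      (∀ (k d s : ℕ) (σ a : ℝ), 1 ≤ k → 2 < d → 1 ≤ s → s < d → 0 < σ → 0 < a →
        c₂ ≤ (d : ℝ) / s →
        a ^ 2 < c₁ * σ ^ 2 *
            max (Real.log (((d : ℝ) - s) / s))
              (Real.sqrt ((k : ℝ) * Real.log (((d : ℝ) - s) / s))) →
        (1 - Real.exp (-1)) / 2 ≤ (s : ℝ)⁻¹ * sInf (HamRiskSetGrp σ k d s a)) := by
  have he := Real.exp_neg_one_gt_d9
  have he1 : Real.exp (-1) < 1 := by simp
  refine ⟨1 / 2, 17, by norm_num, by norm_num, ?_, ?_⟩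
  · intro k d s σ a hk _ hs hsd hσ ha hc h
    refine ⟨sInf_wrongRiskSetGrp_le σ k d s a, ?_⟩
    have hcosh := cosh_pow_le_of_sq_lt hσ ha hk (by linarith) h
    have h1 := half_le_sInf_wrongRiskSetGrp hσ ha hk hs (d := d) (m := d - s + 1) (by omega) (by omega)
      (hcosh.trans (by push_cast [Nat.cast_sub hsd.le]; linarith))
    nlinarith
  · intro k d s σ a hk _ hs _ hσ ha hc h
    have hs' : (0 : ℝ) < s := by exact_mod_cast hs
    have hn : ((d : ℝ) - s) / s = d / s - 1 := by field_simp
    have hfloor : (d : ℝ) / s - 1 < (d / s : ℕ) := by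
      have := Nat.lt_floor_add_one ((d : ℝ) / s)
      rw [Nat.floor_div_eq_div] at this
      linarith
    have hcosh := cosh_pow_le_of_sq_lt hσ ha hk (by rw [hn]; linarith) h
    have hm : 1 ≤ d / s := by
      have : (0 : ℝ) < (d / s : ℕ) := by linarith
      exact_mod_cast this
    have h1 := half_mul_le_sInf_hamRiskSetGrp hσ ha hk hm (Nat.mul_div_le d s)
      (hcosh.trans (by rw [hn]; linarith))
    have h2 : (s : ℝ)⁻¹ * (s / 2) ≤ (s : ℝ)⁻¹ * sInf (HamRiskSetGrp σ k d s a) := by gcongr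
    have h3 : (s : ℝ)⁻¹ * (s / 2) = 1 / 2 := by field_simp
    have h4 := Real.exp_pos (-1)
    linarith

end
end
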